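/- arXiv:2303.06802 — 3 statements merged into one kernel-verified Lean document; each statement's English description precedes it below -/
import Mathlib

section
/- For every constant γ>0 there exists a constant C>0 such that for every n∈ℕ and every 0<ε<1, letting d = ⌈C·log₂(n/ε)⌉, for every k with C·log₂(d/ε) ≤ k ≤ n there exists a function snmExt : {0,1}^n × {0,1}^d → {0,1}^m with output length m = ⌊(1−γ)k/2⌋ that is a strong seeded non-malleable extractor for (n,k)-sources with error ε. (Explicitness/efficient computability is omitted; only existence is asserted.) -/
/-- `Bits n` is the set of `n`-bit strings `{0,1}^n`. -/
abbrev Bits (n : ℕ) : Type := Fin n → Bool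

/-- Statistical distance `Δ(p,q) = max_{T ⊆ S} |p(T) - q(T)|`. -/
noncomputable def sd {α : Type*} [Fintype α] (p q : PMF α) : ℝ :=
  ⨆ T : Finset α, |∑ x ∈ T, (p x).toReal - ∑ x ∈ T, (q x).toReal|

/-- `X` has min-entropy at least `k`, i.e. `Pr[X = x] ≤ 2^{-k}` for all `x`. -/
def minEntropyGe {α : Type*} (p : PMF α) (k : ℝ) : Prop :=
  ∀ x, (p x).toReal ≤ (2 : ℝ) ^ (-k)

/-- Joint distribution of two independent random variables. -/
noncomputable def prodPMF {α β : Type*} (p : PMF α) (q : PMF β) : PMF (α × β) :=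
  p.bind fun x => q.map fun y => (x, y)

open Finset

/-- Advantage of the test `T` at seed `y` for the output table `h` under the tampering `A`:
the value of `T` minus its average when the first output is replaced by a uniform one. -/
noncomputable def advantage {Y Z : Type*} [Fintype Z] [DecidableEq Y] [DecidableEq Z]
    (A : Y → Y) (T : Finset (Z × Z × Y)) (h : Y → Z) (y : Y) : ℝ :=
  (if (h y, h (A y), y) ∈ T then 1 else 0) -
    (Fintype.card Z : ℝ)⁻¹ * ∑ u, if (u, h (A y), y) ∈ T then 1 else 0

/-- Total advantage of the test `T` over all seeds. -/
noncomputable def totalAdvantage {Y Z : Type*} [Fintype Y] [Fintype Z] [DecidableEq Y]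
    [DecidableEq Z] (A : Y → Y) (T : Finset (Z × Z × Y)) (h : Y → Z) : ℝ :=
  ∑ y, advantage A T h y

theorem abs_advantage_le_one {Y Z : Type*} [Fintype Z] [DecidableEq Y] [DecidableEq Z]
    (A : Y → Y) (T : Finset (Z × Z × Y)) (h : Y → Z) (y : Y) : |advantage A T h y| ≤ 1 := by
  have hz : 0 < (Fintype.card Z : ℝ) := by
    have : Nonempty Z := ⟨h y⟩
    exact_mod_cast Fintype.card_pos
  have h0 : (0 : ℝ) ≤ ∑ u, if (u, h (A y), y) ∈ T then (1 : ℝ) else 0 :=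
    sum_nonneg fun u _ => by split_ifs <;> norm_num
  have h1 : (∑ u, if (u, h (A y), y) ∈ T then (1 : ℝ) else 0) ≤ Fintype.card Z := by
    calc (∑ u, if (u, h (A y), y) ∈ T then (1 : ℝ) else 0) ≤ ∑ _u : Z, (1 : ℝ) :=
          sum_le_sum fun u _ => by split_ifs <;> norm_num
      _ = Fintype.card Z := by simp
  have h2 : 0 ≤ (Fintype.card Z : ℝ)⁻¹ * ∑ u, if (u, h (A y), y) ∈ T then (1 : ℝ) else 0 := by
    positivity
  have h3 : (Fintype.card Z : ℝ)⁻¹ * (∑ u, if (u, h (A y), y) ∈ T then (1 : ℝ) else 0) ≤ 1 := by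
    rw [inv_mul_le_iff₀ hz]; linarith
  unfold advantage
  rw [abs_le]
  split_ifs <;> constructor <;> linarith

theorem totalAdvantage_le_card {Y Z : Type*} [Fintype Y] [Fintype Z] [DecidableEq Y]
    [DecidableEq Z] (A : Y → Y) (T : Finset (Z × Z × Y)) (h : Y → Z) :
    totalAdvantage A T h ≤ Fintype.card Y := by
  calc totalAdvantage A T h ≤ ∑ _y : Y, (1 : ℝ) :=
        sum_le_sum fun y _ => (abs_le.1 (abs_advantage_le_one A T h y)).2
    _ = Fintype.card Y := by simp

theorem totalAdvantage_compl {Y Z : Type*} [Fintype Y] [Fintype Z] [DecidableEq Y]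
    [DecidableEq Z] (A : Y → Y) (T : Finset (Z × Z × Y)) (h : Y → Z) :
    totalAdvantage A Tᶜ h = -totalAdvantage A T h := by
  unfold totalAdvantage
  rw [← sum_neg_distrib]
  refine sum_congr rfl fun y _ => ?_
  have hz : (Fintype.card Z : ℝ) ≠ 0 := by
    have : Nonempty Z := ⟨h y⟩
    exact_mod_cast Fintype.card_ne_zero
  have key : ∀ p : Z × Z × Y, (if p ∈ Tᶜ then (1 : ℝ) else 0) = 1 - if p ∈ T then 1 else 0 := by
    intro p
    by_cases hp : p ∈ T <;> simp [hp]
  unfold advantage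
  simp only [key, sum_sub_distrib, sum_const, card_univ, nsmul_eq_mul, mul_one, mul_sub,
    inv_mul_cancel₀ hz]
  ring

/-- Resampling one coordinate of a uniformly random function. -/
theorem sum_sum_update {Y Z : Type*} [Fintype Y] [Fintype Z] [DecidableEq Y]
    (F : (Y → Z) → ℝ) (y : Y) :
    ∑ h : Y → Z, ∑ u, F (Function.update h y u) = Fintype.card Z * ∑ h, F h := by
  have hinv : Function.Involutive
      (fun p : (Y → Z) × Z => (Function.update p.1 y p.2, p.1 y)) := by
    rintro ⟨h, u⟩
    simp
  calc ∑ h : Y → Z, ∑ u, F (Function.update h y u)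
      = ∑ p : (Y → Z) × Z, F (Function.update p.1 y p.2) := by
        rw [Fintype.sum_prod_type]
    _ = ∑ p : (Y → Z) × Z, F p.1 := Fintype.sum_equiv hinv.toPerm _ _ fun _ => rfl
    _ = Fintype.card Z * ∑ h, F h := by
        rw [Fintype.sum_prod_type]
        simp [mul_sum]

theorem sum_exp_mul_le {Z : Type*} [Fintype Z] (v : Z → ℝ) (hv : ∀ u, |v u| ≤ 1)
    (hsum : ∑ u, v u = 0) {t : ℝ} (ht : |t| ≤ 1) :
    ∑ u, Real.exp (t * v u) ≤ Fintype.card Z * Real.exp (t ^ 2) := by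
  have hb : ∀ u, Real.exp (t * v u) ≤ 1 + t * v u + t ^ 2 := by
    intro u
    have h1 : |t * v u| ≤ 1 := by
      rw [abs_mul]
      exact mul_le_one₀ ht (abs_nonneg _) (hv u)
    have h2 := (abs_le.1 (Real.abs_exp_sub_one_sub_id_le h1)).2
    have h3 : v u ^ 2 ≤ 1 := (sq_le_one_iff_abs_le_one _).2 (hv u)
    nlinarith [sq_nonneg t]
  calc ∑ u, Real.exp (t * v u) ≤ ∑ u, (1 + t * v u + t ^ 2) := sum_le_sum fun u _ => hb u
    _ = Fintype.card Z * (1 + t ^ 2) := by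
        simp only [sum_add_distrib, ← mul_sum, hsum, sum_const, card_univ, nsmul_eq_mul]
        ring
    _ ≤ Fintype.card Z * Real.exp (t ^ 2) := by
        gcongr
        linarith [Real.add_one_le_exp (t ^ 2)]

/-- Exponential moment of the advantage over a set of seeds disjoint from its tampered image. -/
theorem sum_exp_advantage_le {Y Z : Type*} [Fintype Y] [Fintype Z] [DecidableEq Y]
    [DecidableEq Z] [Nonempty Z] (A : Y → Y) (T : Finset (Z × Z × Y)) {t : ℝ} (ht : |t| ≤ 1)
    (P : Finset Y) (hP : ∀ y ∈ P, A y ∉ P) :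
    ∑ h : Y → Z, Real.exp (t * ∑ y ∈ P, advantage A T h y) ≤
      Fintype.card (Y → Z) * Real.exp (t ^ 2) ^ P.card := by
  induction P using Finset.induction_on with
  | empty => simp
  | insert a P ha ih =>
    have hz : 0 < (Fintype.card Z : ℝ) := by exact_mod_cast Fintype.card_pos
    have hAa : A a ≠ a := by
      intro h
      exact hP a (mem_insert_self a P) (by rw [h]; exact mem_insert_self a P)
    have hrest : ∀ (h : Y → Z) (u : Z),
        ∑ y ∈ P, advantage A T (Function.update h a u) y = ∑ y ∈ P, advantage A T h y := by
      intro h u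
      refine sum_congr rfl fun y hy => ?_
      have h1 : y ≠ a := fun h => ha (h ▸ hy)
      have h2 : A y ≠ a := fun h => hP y (mem_insert_of_mem hy) (h ▸ mem_insert_self _ P)
      simp [advantage, Function.update_of_ne h1, Function.update_of_ne h2]
    have hmean : ∀ h : Y → Z, ∑ u, advantage A T (Function.update h a u) a = 0 := by
      intro h
      simp only [advantage, Function.update_self, Function.update_of_ne hAa, sum_sub_distrib,
        sum_const, card_univ, nsmul_eq_mul]
      rw [mul_inv_cancel_left₀ hz.ne', sub_self]
    have ih' := ih fun y hy hAy => hP y (mem_insert_of_mem hy) (mem_insert_of_mem hAy)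
    refine le_of_mul_le_mul_left ?_ hz
    rw [← sum_sum_update _ a]
    calc ∑ h : Y → Z, ∑ u,
          Real.exp (t * ∑ y ∈ insert a P, advantage A T (Function.update h a u) y)
        = ∑ h : Y → Z, (∑ u, Real.exp (t * advantage A T (Function.update h a u) a)) *
            Real.exp (t * ∑ y ∈ P, advantage A T h y) := by
          refine sum_congr rfl fun h _ => ?_
          rw [sum_mul]
          refine sum_congr rfl fun u _ => ?_
          rw [sum_insert ha, hrest, mul_add, Real.exp_add]
      _ ≤ ∑ h : Y → Z, (Fintype.card Z * Real.exp (t ^ 2)) *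
            Real.exp (t * ∑ y ∈ P, advantage A T h y) := by
          gcongr with h
          exact sum_exp_mul_le _ (fun u => abs_advantage_le_one _ _ _ _) (hmean h) ht
      _ ≤ (Fintype.card Z * Real.exp (t ^ 2)) *
            (Fintype.card (Y → Z) * Real.exp (t ^ 2) ^ P.card) := by
          rw [← mul_sum]
          gcongr
      _ = _ := by
          rw [card_insert_of_notMem ha]
          ring

/-- Exponential moment of the total advantage when `c` is a proper colouring of the graph
of the tampering function. -/
theorem sum_exp_totalAdvantage_le {Y Z ι : Type*} [Fintype Y] [Fintype Z] [Fintype ι]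
    [DecidableEq Y] [DecidableEq Z] [DecidableEq ι] [Nonempty Z] [Nonempty ι]
    (A : Y → Y) (T : Finset (Z × Z × Y)) (c : Y → ι) (hc : ∀ y, c (A y) ≠ c y)
    {t : ℝ} (ht : |t| ≤ 1) :
    ∑ h : Y → Z, Real.exp (t / Fintype.card ι * totalAdvantage A T h) ≤
      Fintype.card (Y → Z) * Real.exp (t ^ 2 * Fintype.card Y) := by
  have hι : 0 < (Fintype.card ι : ℝ) := by exact_mod_cast Fintype.card_pos
  have hjensen : ∀ h : Y → Z, Real.exp (t / Fintype.card ι * totalAdvantage A T h) ≤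
      ∑ i, (Fintype.card ι : ℝ)⁻¹ *
        Real.exp (t * ∑ y ∈ univ.filter (c · = i), advantage A T h y) := by
    intro h
    have := convexOn_exp.map_sum_le (t := univ) (w := fun _ : ι => (Fintype.card ι : ℝ)⁻¹)
      (p := fun i => t * ∑ y ∈ univ.filter (c · = i), advantage A T h y)
      (fun _ _ => by positivity) (by simp [hι.ne']) (fun _ _ => Set.mem_univ _)
    simp only [smul_eq_mul] at this
    refine le_trans (le_of_eq ?_) this
    rw [← mul_sum, ← mul_sum, sum_fiberwise]
    unfold totalAdvantage
    ring_nf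
  calc ∑ h : Y → Z, Real.exp (t / Fintype.card ι * totalAdvantage A T h)
      ≤ ∑ h : Y → Z, ∑ i, (Fintype.card ι : ℝ)⁻¹ *
        Real.exp (t * ∑ y ∈ univ.filter (c · = i), advantage A T h y) :=
        sum_le_sum fun h _ => hjensen h
    _ = ∑ i, (Fintype.card ι : ℝ)⁻¹ *
        ∑ h : Y → Z, Real.exp (t * ∑ y ∈ univ.filter (c · = i), advantage A T h y) := by
        rw [sum_comm]
        simp only [mul_sum]
    _ ≤ ∑ _i : ι, (Fintype.card ι : ℝ)⁻¹ *
        (Fintype.card (Y → Z) * Real.exp (t ^ 2 * Fintype.card Y)) := by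
        gcongr with i
        refine (sum_exp_advantage_le A T ht _ ?_).trans ?_
        · intro y hy hAy
          simp only [mem_filter, mem_univ, true_and] at hy hAy
          exact hc y (hAy.trans hy.symm)
        · rw [← Real.exp_nat_mul, mul_comm _ (t ^ 2)]
          gcongr
          exact card_le_univ _
    _ = _ := by
        rw [sum_const, card_univ, nsmul_eq_mul, mul_inv_cancel_left₀ hι.ne']

/-- A potential with average at most `exp 1` times the number of tests stays below that bound
for some function, and so few rows of that function are far from the mean. -/
theorem exists_forall_card_mul_le {X H J : Type*} [Fintype X] [Fintype H] [Fintype J]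
    [DecidableEq X] [Nonempty X] [Nonempty H] [Nonempty J] (φ : J → H → ℝ) (s a : ℝ)
    (hφ : ∀ j, ∑ h, Real.exp (φ j h) ≤ Fintype.card H * Real.exp s) :
    ∃ f : X → H, ∀ j, ∀ B : Finset X, (∀ x ∈ B, a ≤ φ j (f x)) →
      B.card * (a - s - Real.log (Fintype.card X)) ≤ Real.log (Fintype.card J) + 1 := by
  set N : ℝ := (Fintype.card X : ℝ) with hN
  have hN0 : 0 < N := by rw [hN]; exact_mod_cast Fintype.card_pos
  have hJ0 : 0 < (Fintype.card J : ℝ) := by exact_mod_cast Fintype.card_pos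
  set ψ : J → H → ℝ := fun j h => 1 + N⁻¹ * Real.exp (-s) * Real.exp (φ j h) with hψ
  have hψ1 : ∀ j h, 1 ≤ ψ j h := fun j h => by
    have : 0 ≤ N⁻¹ * Real.exp (-s) * Real.exp (φ j h) := by positivity
    simp only [hψ]; linarith
  have hrow : ∀ j, ∑ h, ψ j h ≤ Fintype.card H * Real.exp N⁻¹ := by
    intro j
    calc ∑ h, ψ j h = Fintype.card H + N⁻¹ * Real.exp (-s) * ∑ h, Real.exp (φ j h) := by
          simp [hψ, sum_add_distrib, mul_sum]
      _ ≤ Fintype.card H + N⁻¹ * Real.exp (-s) * (Fintype.card H * Real.exp s) := by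
          gcongr
          exact hφ j
      _ = Fintype.card H * (N⁻¹ + 1) := by
          have : Real.exp (-s) * Real.exp s = 1 := by rw [← Real.exp_add]; simp
          linear_combination (N⁻¹ * Fintype.card H) * this
      _ ≤ _ := by
          gcongr
          exact Real.add_one_le_exp _
  have htot : ∑ f : X → H, ∑ j, ∏ x, ψ j (f x) ≤
      ∑ _f : X → H, (Fintype.card J * Real.exp 1 : ℝ) := by
    calc ∑ f : X → H, ∑ j, ∏ x, ψ j (f x) = ∑ j, ∑ f : X → H, ∏ x, ψ j (f x) := sum_comm
      _ = ∑ j, ∏ _x : X, ∑ h, ψ j h := by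
          refine sum_congr rfl fun j _ => ?_
          rw [prod_univ_sum, Fintype.piFinset_univ]
      _ ≤ ∑ _j : J, (Fintype.card H * Real.exp N⁻¹) ^ Fintype.card X := by
          refine sum_le_sum fun j _ => ?_
          rw [prod_const, card_univ]
          exact pow_le_pow_left₀ (sum_nonneg fun h _ => zero_le_one.trans (hψ1 j h)) (hrow j) _
      _ = _ := by
          rw [mul_pow, ← Real.exp_nat_mul, ← hN, mul_inv_cancel₀ hN0.ne']
          simp
          ring
  obtain ⟨f, -, hf⟩ := exists_le_of_sum_le univ_nonempty htot
  refine ⟨f, fun j B hB => ?_⟩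
  have hb : Real.exp (a - s - Real.log N) ^ B.card ≤ Fintype.card J * Real.exp 1 := by
    calc Real.exp (a - s - Real.log N) ^ B.card = ∏ _x ∈ B, Real.exp (a - s - Real.log N) := by
          rw [prod_const]
      _ ≤ ∏ x ∈ B, ψ j (f x) := by
          refine prod_le_prod (fun _ _ => (Real.exp_pos _).le) fun x hx => ?_
          have h1 : Real.exp (a - s - Real.log N) = N⁻¹ * Real.exp (-s) * Real.exp a := by
            rw [Real.exp_sub, Real.exp_log hN0, sub_eq_add_neg, Real.exp_add]
            field_simp
          have h2 : N⁻¹ * Real.exp (-s) * Real.exp a ≤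
              N⁻¹ * Real.exp (-s) * Real.exp (φ j (f x)) := by
            gcongr
            exact hB x hx
          simp only [hψ]
          linarith
      _ ≤ ∏ x, ψ j (f x) :=
          prod_le_prod_of_subset_of_one_le (subset_univ B)
            (fun x _ => zero_le_one.trans (hψ1 j _)) fun x _ _ => hψ1 j _
      _ ≤ ∑ j, ∏ x, ψ j (f x) :=
          single_le_sum (f := fun j => ∏ x, ψ j (f x))
            (fun j _ => prod_nonneg fun x _ => zero_le_one.trans (hψ1 j _)) (mem_univ j)
      _ ≤ _ := hf
  rw [← Real.exp_nat_mul, ← Real.exp_log hJ0, ← Real.exp_add] at hb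
  exact Real.exp_le_exp.1 hb

theorem prodPMF_apply {α β : Type*} [Fintype α] [Fintype β] (p : PMF α) (q : PMF β)
    (a : α) (b : β) : prodPMF p q (a, b) = p a * q b := by
  classical
  simp only [prodPMF, PMF.bind_apply, PMF.map_apply, tsum_fintype, Prod.mk.injEq]
  rw [sum_eq_single a]
  · congr 1
    rw [sum_eq_single b] <;> simp +contextual [eq_comm]
  · intro x _ hx
    simp [hx.symm]
  · simp

theorem sum_map_toReal {α β : Type*} [Fintype α] [DecidableEq β] (p : PMF α) (F : α → β)
    (T : Finset β) :
    ∑ b ∈ T, ((p.map F) b).toReal = ∑ a, (p a).toReal * if F a ∈ T then 1 else 0 := by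
  classical
  have h : ∀ b, ((p.map F) b).toReal = ∑ a, if b = F a then (p a).toReal else 0 := by
    intro b
    rw [PMF.map_apply, tsum_fintype, ENNReal.toReal_sum]
    · refine sum_congr rfl fun a _ => ?_
      split_ifs <;> simp
    · intro a _
      split_ifs
      · exact p.apply_ne_top a
      · simp
  simp only [h]
  rw [sum_comm]
  refine sum_congr rfl fun a _ => ?_
  rw [sum_ite_eq']
  simp

/-- The advantage of a test in distinguishing the two distributions of the non-malleability
condition, as an average of total advantages. -/
theorem sum_sub_sum_eq {X Y Z : Type*} [Fintype X] [Fintype Y] [Fintype Z] [DecidableEq Y]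
    [DecidableEq Z] [Nonempty Y] [Nonempty Z] (p : PMF X) (f : X → Y → Z) (A : Y → Y)
    (T : Finset (Z × Z × Y)) :
    ∑ t ∈ T, (((prodPMF p (PMF.uniformOfFintype Y)).map
        fun xy => (f xy.1 xy.2, f xy.1 (A xy.2), xy.2)) t).toReal -
      ∑ t ∈ T, ((prodPMF (PMF.uniformOfFintype Z) ((prodPMF p (PMF.uniformOfFintype Y)).map
        fun xy => (f xy.1 (A xy.2), xy.2))) t).toReal =
      ∑ x, (p x).toReal * ((Fintype.card Y : ℝ)⁻¹ * totalAdvantage A T (f x)) := by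
  have h2 : ∑ t ∈ T, ((prodPMF (PMF.uniformOfFintype Z)
        ((prodPMF p (PMF.uniformOfFintype Y)).map
          fun xy => (f xy.1 (A xy.2), xy.2))) t).toReal =
      ∑ u : Z, (Fintype.card Z : ℝ)⁻¹ * ∑ x, ∑ y, ((p x).toReal * (Fintype.card Y : ℝ)⁻¹) *
        if (u, f x (A y), y) ∈ T then 1 else 0 := by
    rw [← univ_inter T, ← sum_ite_mem, Fintype.sum_prod_type]
    refine sum_congr rfl fun u _ => ?_
    calc ∑ w, (if (u, w) ∈ T then ((prodPMF (PMF.uniformOfFintype Z)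
            ((prodPMF p (PMF.uniformOfFintype Y)).map
              fun xy => (f xy.1 (A xy.2), xy.2))) (u, w)).toReal else 0)
        = (Fintype.card Z : ℝ)⁻¹ * ∑ w ∈ univ.filter fun w => (u, w) ∈ T,
            (((prodPMF p (PMF.uniformOfFintype Y)).map
              fun xy => (f xy.1 (A xy.2), xy.2)) w).toReal := by
          rw [mul_sum, sum_filter]
          simp [prodPMF_apply]
      _ = _ := by
          rw [sum_map_toReal, Fintype.sum_prod_type]
          simp [prodPMF_apply]
  rw [h2, sum_map_toReal, Fintype.sum_prod_type]
  simp only [prodPMF_apply, PMF.uniformOfFintype_apply, ENNReal.toReal_mul, ENNReal.toReal_inv,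
    ENNReal.toReal_natCast]
  have h3 : ∑ u : Z, (Fintype.card Z : ℝ)⁻¹ * ∑ x, ∑ y,
        ((p x).toReal * (Fintype.card Y : ℝ)⁻¹) * (if (u, f x (A y), y) ∈ T then 1 else 0) =
      ∑ x, ∑ y, ((p x).toReal * (Fintype.card Y : ℝ)⁻¹) *
        ((Fintype.card Z : ℝ)⁻¹ * ∑ u, if (u, f x (A y), y) ∈ T then 1 else 0) := by
    simp only [mul_sum]
    rw [sum_comm]
    refine sum_congr rfl fun x _ => ?_
    rw [sum_comm]
    exact sum_congr rfl fun y _ => sum_congr rfl fun u _ => mul_left_comm _ _ _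
  rw [h3, ← sum_sub_distrib]
  refine sum_congr rfl fun x _ => ?_
  rw [← sum_sub_distrib, totalAdvantage, ← mul_assoc, mul_sum]
  exact sum_congr rfl fun y _ => (mul_sub _ _ _).symm

theorem sd_le_of_forall {X Y Z : Type*} [Fintype X] [Fintype Y] [Fintype Z] [DecidableEq Y]
    [DecidableEq Z] [Nonempty Y] [Nonempty Z] (p : PMF X) (f : X → Y → Z) (A : Y → Y) {ε : ℝ}
    (h : ∀ T : Finset (Z × Z × Y),
      ∑ x, (p x).toReal * ((Fintype.card Y : ℝ)⁻¹ * totalAdvantage A T (f x)) ≤ ε) :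
    sd ((prodPMF p (PMF.uniformOfFintype Y)).map
        fun xy => (f xy.1 xy.2, f xy.1 (A xy.2), xy.2))
      (prodPMF (PMF.uniformOfFintype Z) ((prodPMF p (PMF.uniformOfFintype Y)).map
        fun xy => (f xy.1 (A xy.2), xy.2))) ≤ ε := by
  refine ciSup_le fun T => ?_
  rw [sum_sub_sum_eq, abs_le]
  refine ⟨?_, h T⟩
  have := h Tᶜ
  simp only [totalAdvantage_compl, mul_neg, sum_neg_distrib] at this
  linarith

/-- If at most `b` points have value at least `δ`, a distribution with point masses at most `κ`
has expectation at most `δ + b * κ`. -/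
theorem sum_toReal_mul_le {X : Type*} [Fintype X] (p : PMF X) (g : X → ℝ) (hg : ∀ x, g x ≤ 1)
    {δ κ b : ℝ} (hδ : 0 ≤ δ) (hκ : 0 ≤ κ) (hp : ∀ x, (p x).toReal ≤ κ)
    (hb : ((univ.filter fun x => δ ≤ g x).card : ℝ) ≤ b) :
    ∑ x, (p x).toReal * g x ≤ δ + b * κ := by
  have hp1 : ∑ x, (p x).toReal = 1 := by
    rw [← ENNReal.toReal_sum fun x _ => p.apply_ne_top x, ← tsum_fintype (L := .unconditional X),
      p.tsum_coe]
    simp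
  calc ∑ x, (p x).toReal * g x ≤ ∑ x, ((p x).toReal * δ + if δ ≤ g x then κ else 0) := by
        refine sum_le_sum fun x _ => ?_
        have h0 : 0 ≤ (p x).toReal := ENNReal.toReal_nonneg
        split_ifs with hx
        · nlinarith [hp x, hg x]
        · nlinarith
    _ = δ + (univ.filter fun x => δ ≤ g x).card * κ := by
        rw [sum_add_distrib, ← sum_mul, hp1, ← sum_filter, sum_const, nsmul_eq_mul, one_mul]
    _ ≤ δ + b * κ := by gcongr

theorem exists_coloring {d : ℕ} (A : Bits d → Bits d) (hA : ∀ y, A y ≠ y) :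
    ∃ c : Bits d → Fin d × Bool, ∀ y, c (A y) ≠ c y := by
  choose j hj using fun y => Function.ne_iff.1 (hA y)
  refine ⟨fun y => (j y, y (j y)), fun y h => hj y ?_⟩
  obtain ⟨h1, h2⟩ := Prod.mk.inj h
  rwa [h1] at h2

theorem log_card_tests_le (d m : ℕ) :
    Real.log (Fintype.card ({A : Bits d → Bits d // ∀ y, A y ≠ y} ×
      Finset (Bits m × Bits m × Bits d))) ≤ (d + (2 ^ m) ^ 2) * 2 ^ d := by
  set a := Fintype.card {A : Bits d → Bits d // ∀ y, A y ≠ y} with ha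
  have h1 : a ≤ 2 ^ (d * 2 ^ d) := by
    calc a ≤ Fintype.card (Bits d → Bits d) := Fintype.card_subtype_le _
      _ = _ := by simp [pow_mul]
  have h2 : Fintype.card (Finset (Bits m × Bits m × Bits d)) =
      2 ^ ((2 ^ m) ^ 2 * 2 ^ d) := by
    simp [pow_two, mul_assoc]
  rw [Fintype.card_prod, ← ha, h2]
  rcases Nat.eq_zero_or_pos a with h | h
  · rw [h]
    simp
    positivity
  have h3 : ((a * 2 ^ ((2 ^ m) ^ 2 * 2 ^ d) : ℕ) : ℝ) ≤
      2 ^ ((d + (2 ^ m) ^ 2) * 2 ^ d) := by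
    rw [add_mul, pow_add]
    push_cast
    gcongr
    exact_mod_cast h1
  calc _ ≤ Real.log (2 ^ ((d + (2 ^ m) ^ 2) * 2 ^ d)) := Real.log_le_log (by positivity) h3
    _ = ((d + (2 ^ m) ^ 2) * 2 ^ d) * Real.log 2 := by
        rw [Real.log_pow]
        push_cast
        ring
    _ ≤ (d + (2 ^ m) ^ 2) * 2 ^ d := by
        refine mul_le_of_le_one_right (by positivity) ?_
        linarith [Real.log_two_lt_d9]

/-- Existence of strong non-malleable extractors from explicit size conditions. -/
theorem exists_nonmalleable_table {n d m : ℕ} {ε κ : ℝ} (hε : 0 < ε) (hε1 : ε < 1)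
    (hd : 1000 ≤ d) (hD : 128 * d ^ 2 * n ≤ ε ^ 2 * 2 ^ d) (hκ0 : 0 ≤ κ)
    (hκ : 768 * d ^ 3 * (2 ^ m) ^ 2 * κ ≤ ε ^ 3) :
    ∃ f : Bits n → Bits d → Bits m, ∀ p : PMF (Bits n), (∀ x, (p x).toReal ≤ κ) →
      ∀ A : Bits d → Bits d, (∀ y, A y ≠ y) →
        sd ((prodPMF p (PMF.uniformOfFintype (Bits d))).map
            fun xy => (f xy.1 xy.2, f xy.1 (A xy.2), xy.2))
          (prodPMF (PMF.uniformOfFintype (Bits m))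
            ((prodPMF p (PMF.uniformOfFintype (Bits d))).map
              fun xy => (f xy.1 (A xy.2), xy.2))) ≤ ε := by
  have hd0 : (1000 : ℝ) ≤ d := by exact_mod_cast hd
  have hdpos : (0 : ℝ) < d := by linarith
  have hne : Nonempty {A : Bits d → Bits d // ∀ y, A y ≠ y} := by
    refine ⟨⟨fun y i => !(y i), fun y h => ?_⟩⟩
    have := congrFun h ⟨0, by omega⟩
    simp at this
  have hι : Nonempty (Fin d × Bool) := ⟨(⟨0, by omega⟩, true)⟩
  have hcι : (Fintype.card (Fin d × Bool) : ℝ) = 2 * d := by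
    simp [mul_comm]
  have hcY : (Fintype.card (Bits d) : ℝ) = 2 ^ d := by simp
  set D : ℝ := 2 ^ d with hDdef
  have hD0 : 0 < D := by positivity
  have hD1 : 1 ≤ D := one_le_pow₀ (by norm_num)
  set t : ℝ := ε / (8 * d) with ht
  have ht0 : 0 < t := by positivity
  have ht1 : |t| ≤ 1 := by
    rw [abs_of_pos ht0, ht, div_le_one (by positivity)]
    linarith
  obtain ⟨f, hf⟩ := exists_forall_card_mul_le (X := Bits n) (H := Bits d → Bits m)
    (J := {A : Bits d → Bits d // ∀ y, A y ≠ y} × Finset (Bits m × Bits m × Bits d))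
    (fun j h => t / (2 * d) * totalAdvantage j.1.1 j.2 h) (t ^ 2 * D)
    (t / (2 * d) * (ε / 2 * D)) (by
      rintro ⟨⟨A, hA⟩, T⟩
      obtain ⟨c, hc⟩ := exists_coloring A hA
      have := sum_exp_totalAdvantage_le (Z := Bits m) A T c hc ht1
      rwa [hcι, hcY] at this)
  refine ⟨f, fun p hp A hA => sd_le_of_forall p f A fun T => ?_⟩
  rw [hcY]
  have hcard := hf (⟨A, hA⟩, T) (univ.filter fun x => ε / 2 ≤ D⁻¹ * totalAdvantage A T (f x)) (by
    intro x hx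
    simp only [mem_filter, mem_univ, true_and] at hx
    have : ε / 2 * D ≤ totalAdvantage A T (f x) := by
      rwa [le_inv_mul_iff₀ hD0, mul_comm] at hx
    simp only
    gcongr)
  have hJ := log_card_tests_le d m
  rw [← hDdef] at hJ
  set b : ℝ :=
    ((univ.filter fun x => ε / 2 ≤ D⁻¹ * totalAdvantage A T (f x)).card : ℝ) with hb
  have hb0 : 0 ≤ b := by positivity
  have hM : (1 : ℝ) ≤ (2 ^ m) ^ 2 := one_le_pow₀ (one_le_pow₀ (by norm_num))
  have hlogN : Real.log (Fintype.card (Bits n)) ≤ n := by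
    simp only [Fintype.card_pi, Fintype.card_bool, prod_const, card_univ, Fintype.card_fin,
      Nat.cast_pow, Nat.cast_ofNat, Real.log_pow]
    refine mul_le_of_le_one_right (by positivity) ?_
    linarith [Real.log_two_lt_d9]
  have hexp : ε ^ 2 * D / (128 * d ^ 2) ≤
      t / (2 * d) * (ε / 2 * D) - t ^ 2 * D - Real.log (Fintype.card (Bits n)) := by
    have h1 : (n : ℝ) ≤ ε ^ 2 * D / (128 * d ^ 2) := by
      rw [le_div_iff₀ (by positivity)]
      linarith
    have h2 : t / (2 * d) * (ε / 2 * D) - t ^ 2 * D = 2 * (ε ^ 2 * D / (128 * d ^ 2)) := by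
      rw [ht]
      field_simp
      ring
    linarith
  have hbound : b * (ε ^ 2 * D / (128 * d ^ 2)) ≤ 3 * d * (2 ^ m) ^ 2 * D := by
    calc b * (ε ^ 2 * D / (128 * d ^ 2)) ≤ (d + (2 ^ m) ^ 2) * D + 1 :=
          (mul_le_mul_of_nonneg_left hexp hb0).trans (hcard.trans (by linarith))
      _ ≤ (d + (2 ^ m) ^ 2) * D + D := by linarith
      _ = (d + (2 ^ m) ^ 2 + 1) * D := by ring
      _ ≤ 3 * d * (2 ^ m) ^ 2 * D := by
          gcongr
          nlinarith
  have hbε : b * ε ^ 2 ≤ 384 * d ^ 3 * (2 ^ m) ^ 2 := by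
    have h1 : b * (ε ^ 2 * D / (128 * d ^ 2)) = b * ε ^ 2 / (128 * d ^ 2) * D := by ring
    rw [h1] at hbound
    have h2 := le_of_mul_le_mul_right hbound hD0
    rw [div_le_iff₀ (by positivity)] at h2
    linarith
  have hbκ : b * κ ≤ ε / 2 := by
    have h1 : b * ε ^ 2 * κ ≤ 384 * d ^ 3 * (2 ^ m) ^ 2 * κ := by gcongr
    have h2 : ε ^ 2 * (b * κ) ≤ ε ^ 2 * (ε / 2) := by linarith
    exact le_of_mul_le_mul_left h2 (by positivity)
  have hg : ∀ x, D⁻¹ * totalAdvantage A T (f x) ≤ 1 := by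
    intro x
    rw [inv_mul_le_iff₀ hD0, mul_one, ← hcY]
    exact totalAdvantage_le_card A T (f x)
  have := sum_toReal_mul_le p _ hg (by positivity) hκ0 hp hb.ge
  linarith

theorem totalAdvantage_eq_zero_of_unique {Y Z : Type*} [Fintype Y] [Fintype Z] [Unique Z]
    [DecidableEq Y] [DecidableEq Z] (A : Y → Y) (T : Finset (Z × Z × Y)) (h : Y → Z) :
    totalAdvantage A T h = 0 := by
  refine sum_eq_zero fun y _ => ?_
  rw [advantage, Fintype.card_unique, Fintype.sum_unique, Subsingleton.elim (h y) default]
  simp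

theorem size_bound_of_logb {n d : ℕ} {ε : ℝ} (hε : 0 < ε) (hn : 1 ≤ n) (hd : 1000 ≤ d)
    (h : 4 * Real.logb 2 (n / ε) ≤ d) : 128 * d ^ 2 * n ≤ ε ^ 2 * (2 : ℝ) ^ d := by
  have hd0 : (1000 : ℝ) ≤ d := by exact_mod_cast hd
  have hn0 : (1 : ℝ) ≤ n := by exact_mod_cast hn
  set r : ℝ := (2 : ℝ) ^ ((d : ℝ) / 4) with hr
  have hr4 : (2 : ℝ) ^ d = r ^ 2 * r ^ 2 := by
    rw [hr, ← pow_add, ← Real.rpow_mul_natCast (by norm_num), ← Real.rpow_natCast]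
    congr 1
    push_cast
    ring
  have h1 : (n : ℝ) / ε ≤ r :=
    (Real.logb_le_iff_le_rpow (by norm_num) (by positivity)).1 (by linarith)
  have h2 : 12 * (d : ℝ) ≤ r := by
    have hx : 0.17 * (d : ℝ) ≤ Real.log 2 * (d / 4) := by
      nlinarith [Real.log_two_gt_d9]
    have hq := Real.quadratic_le_exp_of_nonneg (x := 0.17 * (d : ℝ)) (by positivity)
    have hm := Real.exp_le_exp.2 hx
    rw [hr, Real.rpow_def_of_pos (by norm_num)]
    nlinarith
  rw [div_le_iff₀ hε] at h1
  have h3 : (n : ℝ) ^ 2 ≤ (r * ε) ^ 2 := by gcongr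
  have h4 : (12 * (d : ℝ)) ^ 2 ≤ r ^ 2 := by gcongr
  have h5 : (12 * (d : ℝ)) ^ 2 * (n : ℝ) ^ 2 ≤ r ^ 2 * (r * ε) ^ 2 := by gcongr
  have h6 : (n : ℝ) ≤ (n : ℝ) ^ 2 := by nlinarith
  rw [hr4]
  calc 128 * (d : ℝ) ^ 2 * n ≤ 144 * (d : ℝ) ^ 2 * (n : ℝ) ^ 2 := by gcongr; norm_num
    _ ≤ ε ^ 2 * (r ^ 2 * r ^ 2) := by linarith

theorem entropy_bound_of_logb {d m : ℕ} {ε k : ℝ} (hε : 0 < ε) (hε1 : ε < 1) (hd : 1000 ≤ d)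
    (h : 2 * m + 4 * Real.logb 2 (d / ε) ≤ k) :
    768 * d ^ 3 * (2 ^ m) ^ 2 * (2 : ℝ) ^ (-k) ≤ ε ^ 3 := by
  have hd0 : (1000 : ℝ) ≤ d := by exact_mod_cast hd
  have hdε : 0 < (d : ℝ) / ε := by positivity
  have h1 : ((2 : ℝ) ^ m) ^ 2 * (d / ε) ^ 4 ≤ 2 ^ k := by
    calc ((2 : ℝ) ^ m) ^ 2 * (d / ε) ^ 4 = 2 ^ (2 * m + 4 * Real.logb 2 (d / ε)) := by
          rw [Real.rpow_add (by norm_num), mul_comm (4 : ℝ), mul_comm (2 : ℝ) (m : ℝ),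
            Real.rpow_mul (by norm_num), Real.rpow_mul (by norm_num),
            Real.rpow_logb (by norm_num) (by norm_num) hdε]
          norm_cast
      _ ≤ 2 ^ k := Real.rpow_le_rpow_of_exponent_le (by norm_num) h
  rw [Real.rpow_neg (by norm_num), ← div_eq_mul_inv, div_le_iff₀ (by positivity)]
  refine le_trans ?_ (mul_le_mul_of_nonneg_left h1 (by positivity))
  have h2 : ε ^ 3 * (((2 : ℝ) ^ m) ^ 2 * (d / ε) ^ 4) = d ^ 4 / ε * ((2 : ℝ) ^ m) ^ 2 := by
    field_simp
  rw [h2]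
  gcongr
  rw [le_div_iff₀ hε]
  calc 768 * (d : ℝ) ^ 3 * ε ≤ 768 * (d : ℝ) ^ 3 * 1 := by gcongr
    _ ≤ d * (d : ℝ) ^ 3 := by rw [mul_one]; gcongr; linarith
    _ = d ^ 4 := by ring

/-- For every constant `γ > 0` there is a constant `C > 0` such that for every `n` and
every `0 < ε < 1`, letting `d = ⌈C log₂(n/ε)⌉`, for every `k` with
`C log₂(d/ε) ≤ k ≤ n` there exists a strong seeded non-malleable extractor
`snmExt : {0,1}^n × {0,1}^d → {0,1}^m` with `m = ⌊(1-γ)k/2⌋`, error `ε`: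
for every `(n,k)`-source `X` and every tampering function `A` on the seed with no
fixed points,
`Δ((snmExt(X,U_d), snmExt(X,A(U_d)), U_d), (U_m, snmExt(X,A(U_d)), U_d)) ≤ ε`. -/
theorem stmt_6 :
    ∀ γ : ℝ, γ > 0 →
      ∃ C : ℝ, C > 0 ∧
        ∀ n : ℕ, ∀ ε : ℝ, 0 < ε → ε < 1 →
          ∀ d : ℕ, d = ⌈C * Real.logb 2 (n / ε)⌉₊ →
            ∀ k : ℕ, C * Real.logb 2 (d / ε) ≤ (k : ℝ) → k ≤ n →
              ∀ m : ℕ, m = ⌊(1 - γ) * k / 2⌋₊ →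
                ∃ snmExt : Bits n → Bits d → Bits m,
                  ∀ pX : PMF (Bits n), minEntropyGe pX k →
                    ∀ A : Bits d → Bits d, (∀ y, A y ≠ y) →
                      sd ((prodPMF pX (PMF.uniformOfFintype (Bits d))).map
                            fun xy => (snmExt xy.1 xy.2, snmExt xy.1 (A xy.2), xy.2))
                         (prodPMF (PMF.uniformOfFintype (Bits m))
                           ((prodPMF pX (PMF.uniformOfFintype (Bits d))).map
                             fun xy => (snmExt xy.1 (A xy.2), xy.2)))
                        ≤ ε := by
  intro γ hγ
  refine ⟨1000 + 4 / γ, by positivity, ?_⟩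
  intro n ε hε hε1 d hd k hk hkn m hm
  rcases Nat.eq_zero_or_pos m with hm0 | hm0
  · subst hm0
    obtain ⟨f⟩ : Nonempty (Bits n → Bits d → Bits 0) := inferInstance
    refine ⟨f, fun p _ A _ => sd_le_of_forall p f A fun T => ?_⟩
    simp only [totalAdvantage_eq_zero_of_unique, mul_zero, sum_const_zero]
    exact hε.le
  have hmle : (m : ℝ) ≤ (1 - γ) * k / 2 := by
    rw [hm]
    refine Nat.floor_le (le_of_lt ?_)
    by_contra hneg
    rw [Nat.floor_of_nonpos (not_lt.1 hneg)] at hm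
    omega
  have hm1 : (1 : ℝ) ≤ m := by exact_mod_cast hm0
  have hk0 : (0 : ℝ) ≤ k := k.cast_nonneg
  have hk2 : (2 : ℝ) ≤ k := by
    have : 0 ≤ γ * k := by positivity
    linarith
  have hkn' : (k : ℝ) ≤ n := by exact_mod_cast hkn
  have hnε : (2 : ℝ) ≤ n / ε := by
    rw [le_div_iff₀ hε]
    linarith
  have hlog : 1 ≤ Real.logb 2 (n / ε) := by
    rw [Real.le_logb_iff_rpow_le (by norm_num) (by linarith)]
    simpa using hnε
  have hγ4 : 0 < 4 / γ := by positivity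
  have hdle : (1000 + 4 / γ) * Real.logb 2 (n / ε) ≤ d := by
    rw [hd]
    exact Nat.le_ceil _
  have hγlog : 0 ≤ 4 / γ * Real.logb 2 (n / ε) := by positivity
  have hdle' : 1000 * Real.logb 2 (n / ε) ≤ d := by linarith
  have hd1000 : 1000 ≤ d := by
    have : (1000 : ℝ) ≤ d := by linarith
    exact_mod_cast this
  have hd0 : (1000 : ℝ) ≤ d := by exact_mod_cast hd1000
  have hlogd : 0 ≤ Real.logb 2 (d / ε) := by
    refine Real.logb_nonneg (by norm_num) ?_
    rw [le_div_iff₀ hε]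
    linarith
  refine exists_nonmalleable_table hε hε1 hd1000
    (size_bound_of_logb (n := n) hε ?_ hd1000 (by linarith)) (by positivity)
    (entropy_bound_of_logb hε hε1 hd1000 ?_)
  · have : (1 : ℝ) ≤ n := by linarith
    exact_mod_cast this
  · have h1 : γ * ((1000 + 4 / γ) * Real.logb 2 (d / ε)) ≤ γ * k := by gcongr
    have h2 : γ * ((1000 + 4 / γ) * Real.logb 2 (d / ε)) =
        1000 * (γ * Real.logb 2 (d / ε)) + 4 * Real.logb 2 (d / ε) := by
      field_simp
    have h3 : 0 ≤ γ * Real.logb 2 (d / ε) := by positivity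
    linarith
end

section
/- There exists a constant C>1 such that for every constant 0<γ<1 there exists a constant α>0 such that for every n∈ℕ and every k with C·log₂ n ≤ k ≤ n, there exists a function nmExt : {0,1}^n × {0,1}^n → {0,1}^m with output length m ≥ α·k that is a ((2/3+γ)n, k, 2^{−αk}) two-source non-malleable extractor. (Explicitness/efficient computability is omitted; only existence is asserted.) -/
/-- The centred indicator of `T` in its first coordinate. -/
noncomputable def centredIndicator {W : Type*} [Fintype W] [DecidableEq W]
    (T : Finset (W × W)) (u w : W) : ℝ :=
  (if (u, w) ∈ T then 1 else 0) -
    (Fintype.card W : ℝ)⁻¹ * ∑ u', if (u', w) ∈ T then 1 else 0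

section CentredIndicator

variable {W : Type*} [Fintype W] [DecidableEq W] [Nonempty W]

lemma sum_centredIndicator (T : Finset (W × W)) (w : W) :
    ∑ u, centredIndicator T u w = 0 := by
  have h : (Fintype.card W : ℝ) ≠ 0 := by simp
  simp only [centredIndicator, Finset.sum_sub_distrib, Finset.sum_const, Finset.card_univ,
    nsmul_eq_mul]
  rw [← mul_assoc, mul_inv_cancel₀ h, one_mul, sub_self]

lemma centredIndicator_compl (T : Finset (W × W)) (u w : W) :
    centredIndicator Tᶜ u w = -centredIndicator T u w := by
  have h : (Fintype.card W : ℝ) ≠ 0 := by simp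
  have key : ∀ v : W, (if (v, w) ∈ Tᶜ then (1 : ℝ) else 0) =
      1 - if (v, w) ∈ T then 1 else 0 := by
    intro v
    by_cases hv : (v, w) ∈ T <;> simp [hv]
  simp only [centredIndicator, key, Finset.sum_sub_distrib, Finset.sum_const, Finset.card_univ,
    nsmul_eq_mul, mul_one]
  rw [mul_sub, inv_mul_cancel₀ h]
  ring

lemma centredIndicator_le (T : Finset (W × W)) (u w : W) :
    centredIndicator T u w ≤ 1 - (Fintype.card W : ℝ)⁻¹ := by
  have h : 0 < (Fintype.card W : ℝ) := by exact_mod_cast Fintype.card_pos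
  have h1 : (1 : ℝ) ≤ Fintype.card W := by exact_mod_cast Fintype.card_pos
  have hinv : (Fintype.card W : ℝ)⁻¹ ≤ 1 := inv_le_one_of_one_le₀ h1
  have hnn : ∀ v : W, 0 ≤ (if (v, w) ∈ T then (1 : ℝ) else 0) := by
    intro v; split_ifs <;> norm_num
  unfold centredIndicator
  by_cases hu : (u, w) ∈ T
  · have : (1 : ℝ) ≤ ∑ v, if (v, w) ∈ T then (1 : ℝ) else 0 := by
      calc (1 : ℝ) = if (u, w) ∈ T then (1 : ℝ) else 0 := by simp [hu]
        _ ≤ _ := Finset.single_le_sum (f := fun v => if (v, w) ∈ T then (1 : ℝ) else 0)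
            (fun v _ => hnn v) (Finset.mem_univ u)
    have := mul_le_mul_of_nonneg_left this (inv_pos.2 h).le
    simp only [hu, if_true]
    linarith
  · have := mul_nonneg (inv_pos.2 h).le
      (Finset.sum_nonneg (s := Finset.univ) fun v _ => hnn v)
    simp only [hu, if_false]
    linarith

lemma abs_centredIndicator_le (T : Finset (W × W)) (u w : W) :
    |centredIndicator T u w| ≤ 1 - (Fintype.card W : ℝ)⁻¹ := by
  rw [abs_le']
  exact ⟨centredIndicator_le T u w, centredIndicator_compl T u w ▸ centredIndicator_le Tᶜ u w⟩

end CentredIndicator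

/-- Hoeffding's lemma for a centred function on a finite set. -/
lemma sum_exp_mul_le_s8 {W : Type*} [Fintype W] (φ : W → ℝ) (h0 : ∑ u, φ u = 0)
    (h1 : ∀ u, |φ u| ≤ 1) (l : ℝ) :
    ∑ u, Real.exp (l * φ u) ≤ Fintype.card W * Real.exp (l ^ 2 / 2) := by
  have hpt : ∀ u, Real.exp (l * φ u) ≤ Real.cosh l + φ u * Real.sinh l := by
    intro u
    obtain ⟨ha, hb⟩ := abs_le.1 (h1 u)
    have := convexOn_exp.2 (Set.mem_univ l) (Set.mem_univ (-l))
      (show 0 ≤ (1 + φ u) / 2 by linarith) (show 0 ≤ (1 - φ u) / 2 by linarith) (by ring)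
    simp only [smul_eq_mul] at this
    rw [Real.cosh_eq, Real.sinh_eq]
    have e : (1 + φ u) / 2 * l + (1 - φ u) / 2 * -l = l * φ u := by ring
    rw [e] at this
    linarith
  calc ∑ u, Real.exp (l * φ u) ≤ ∑ u, (Real.cosh l + φ u * Real.sinh l) :=
        Finset.sum_le_sum fun u _ => hpt u
    _ = Fintype.card W * Real.cosh l := by
        rw [Finset.sum_add_distrib, ← Finset.sum_mul, h0]; simp
    _ ≤ _ := by gcongr; exact Real.cosh_le_exp_half_sq l

lemma card_mul_sum_eq_sum_sum_update {I W : Type*} [Fintype I] [DecidableEq I] [Fintype W]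
    (z : I) (Φ : (I → W) → ℝ) :
    Fintype.card W * ∑ h, Φ h = ∑ h, ∑ u, Φ (Function.update h z u) := by
  let e : (I → W) × W → (I → W) × W := fun p => (Function.update p.1 z p.2, p.1 z)
  have he : Function.Involutive e := by
    rintro ⟨h, u⟩
    simp [e]
  have := Equiv.sum_comp he.toPerm (fun p : (I → W) × W => Φ p.1)
  simp only [Function.Involutive.coe_toPerm, Fintype.sum_prod_type, e] at this
  rw [this]
  simp [Finset.mul_sum]

section MomentGenerating

variable {I W ι : Type*} [Fintype I] [DecidableEq I] [Fintype W]

/-- Exponential moment bound when every term evaluates its second argument at a point of larger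
rank than its first. -/
lemma sum_exp_le_of_rank_lt [DecidableEq ι] (r : I → ℤ) (φ : W → W → ℝ)
    (h0 : ∀ w, ∑ u, φ u w = 0) (h1 : ∀ u w, |φ u w| ≤ 1) (p q : ι → I)
    (hp : Function.Injective (r ∘ p)) (l : ℝ) (J : Finset ι) (hJ : ∀ j ∈ J, r (p j) < r (q j)) :
    ∑ h : I → W, Real.exp (l * ∑ j ∈ J, φ (h (p j)) (h (q j))) ≤
      Fintype.card (I → W) * Real.exp (l ^ 2 / 2 * J.card) := by
  induction J using Finset.induction_on_min_value (r ∘ p) with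
  | empty => simp
  | insert a s ha hmin ih =>
    have ih := ih fun j hj => hJ j (Finset.mem_insert_of_mem hj)
    have hlt : ∀ j ∈ s, r (p a) < r (p j) := fun j hj =>
      lt_of_le_of_ne (hmin j hj) fun hEq => ha (hp hEq ▸ hj)
    have hqa : q a ≠ p a := fun hEq =>
      (hJ a (Finset.mem_insert_self a s)).ne (by rw [hEq])
    rcases isEmpty_or_nonempty W with hW | hW
    · have : Nonempty I := ⟨p a⟩
      simp
    have hc : 0 < (Fintype.card W : ℝ) := by exact_mod_cast Fintype.card_pos
    refine le_of_mul_le_mul_left ?_ hc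
    rw [card_mul_sum_eq_sum_sum_update (p a)]
    have hupd : ∀ (h : I → W) (u : W), Real.exp (l * ∑ j ∈ insert a s,
        φ (Function.update h (p a) u (p j)) (Function.update h (p a) u (q j))) =
        Real.exp (l * φ u (h (q a))) * Real.exp (l * ∑ j ∈ s, φ (h (p j)) (h (q j))) := by
      intro h u
      rw [Finset.sum_insert ha, mul_add, Real.exp_add]
      congr 3
      · simp [Function.update_of_ne hqa]
      · refine Finset.sum_congr rfl fun j hj => ?_
        have e1 : p j ≠ p a := fun hEq => (hlt j hj).ne (by rw [hEq])
        have e2 : q j ≠ p a := fun hEq =>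
          ((hlt j hj).trans (hJ j (Finset.mem_insert_of_mem hj))).ne (by rw [hEq])
        rw [Function.update_of_ne e1, Function.update_of_ne e2]
    simp only [hupd, ← Finset.sum_mul]
    calc _ ≤ ∑ h : I → W, (Fintype.card W * Real.exp (l ^ 2 / 2)) *
          Real.exp (l * ∑ j ∈ s, φ (h (p j)) (h (q j))) := by
          gcongr with h
          exact sum_exp_mul_le_s8 _ (h0 _) (fun u => h1 u _) l
      _ ≤ (Fintype.card W * Real.exp (l ^ 2 / 2)) *
          (Fintype.card (I → W) * Real.exp (l ^ 2 / 2 * s.card)) := by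
          rw [← Finset.mul_sum]
          gcongr
      _ = _ := by
          rw [Finset.card_insert_of_notMem ha]
          push_cast
          rw [mul_add, Real.exp_add, mul_one]
          ring

lemma sum_exp_le_of_ne [Fintype ι] (φ : W → W → ℝ)
    (h0 : ∀ w, ∑ u, φ u w = 0) (h1 : ∀ u w, |φ u w| ≤ 1) (p q : ι → I)
    (hp : Function.Injective p) (hpq : ∀ j, p j ≠ q j) (l : ℝ) :
    ∑ h : I → W, Real.exp (l * ∑ j, φ (h (p j)) (h (q j))) ≤
      Fintype.card (I → W) * Real.exp (2 * l ^ 2 * Fintype.card ι) := by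
  classical
  let r : I → ℤ := fun i => (Fintype.equivFin I i : ℕ)
  have hr : Function.Injective r := fun i j hij => by simpa [r, Fin.val_inj] using hij
  let J₁ : Finset ι := Finset.univ.filter fun j => r (p j) < r (q j)
  let J₂ : Finset ι := Finset.univ.filter fun j => ¬ r (p j) < r (q j)
  have b₁ := sum_exp_le_of_rank_lt r φ h0 h1 p q (hr.comp hp) (2 * l) J₁ (by simp [J₁])
  have b₂ := sum_exp_le_of_rank_lt (fun i => -r i) φ h0 h1 p q
    ((neg_injective.comp hr).comp hp) (2 * l) J₂ (by
      intro j hj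
      have h2 : ¬ r (p j) < r (q j) := by simpa [J₂] using hj
      have h3 : r (p j) ≠ r (q j) := fun e => hpq j (hr e)
      omega)
  have hcard : ∀ J : Finset ι, (Fintype.card (I → W) : ℝ) * Real.exp ((2 * l) ^ 2 / 2 * J.card) ≤
      Fintype.card (I → W) * Real.exp (2 * l ^ 2 * Fintype.card ι) := by
    intro J
    have : (J.card : ℝ) ≤ Fintype.card ι := by exact_mod_cast J.card_le_univ
    have e : (2 * l) ^ 2 / 2 = 2 * l ^ 2 := by ring
    rw [e]
    gcongr
  have hpt : ∀ h : I → W, Real.exp (l * ∑ j, φ (h (p j)) (h (q j))) ≤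
      (Real.exp (2 * l * ∑ j ∈ J₁, φ (h (p j)) (h (q j))) +
        Real.exp (2 * l * ∑ j ∈ J₂, φ (h (p j)) (h (q j)))) / 2 := by
    intro h
    rw [← Finset.sum_filter_add_sum_filter_not Finset.univ (fun j => r (p j) < r (q j)), mul_add,
      Real.exp_add, mul_assoc 2 l, mul_assoc 2 l, two_mul (l * _), two_mul (l * _), Real.exp_add,
      Real.exp_add]
    nlinarith [sq_nonneg (Real.exp (l * ∑ j ∈ J₁, φ (h (p j)) (h (q j))) -
      Real.exp (l * ∑ j ∈ J₂, φ (h (p j)) (h (q j))))]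
  calc _ ≤ ∑ h : I → W, (Real.exp (2 * l * ∑ j ∈ J₁, φ (h (p j)) (h (q j))) +
        Real.exp (2 * l * ∑ j ∈ J₂, φ (h (p j)) (h (q j)))) / 2 :=
        Finset.sum_le_sum fun h _ => hpt h
    _ ≤ _ := by
        rw [← Finset.sum_div, Finset.sum_add_distrib]
        linarith [hcard J₁, hcard J₂]

end MomentGenerating

/-- Probabilistic method: some `h` has small bias on all combinatorial rectangles, against all
fixed-point-free tamperings and all tests. -/
lemma exists_forall_sum_centredIndicator_le {V W : Type*} [Fintype V] [DecidableEq V] [Fintype W]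
    [DecidableEq W] [Nonempty W] (K : ℕ) (ε : ℝ)
    (hcard : (Fintype.card V : ℝ) ^ (4 * K) * 2 ^ (Fintype.card W ^ 2) <
      Real.exp (ε ^ 2 * K ^ 2 / 8)) (hε : 0 < ε) :
    ∃ h : V × V → W, ∀ a b a' b' : Fin K → V, Function.Injective a → Function.Injective b →
      (∀ i j, (a i, b j) ≠ (a' i, b' j)) → ∀ T : Finset (W × W),
        ∑ i, ∑ j, centredIndicator T (h (a i, b j)) (h (a' i, b' j)) ≤ ε * K ^ 2 := by
  classical
  by_contra! hbad
  let P := ((Fin K → V) × (Fin K → V)) × ((Fin K → V) × (Fin K → V)) × Finset (W × W)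
  let good : Finset P := Finset.univ.filter fun x =>
    Function.Injective x.1.1 ∧ Function.Injective x.1.2 ∧
      ∀ i j, (x.1.1 i, x.1.2 j) ≠ (x.2.1.1 i, x.2.1.2 j)
  let S : P → (V × V → W) → ℝ := fun x h =>
    ∑ t : Fin K × Fin K, centredIndicator x.2.2 (h (x.1.1 t.1, x.1.2 t.2))
      (h (x.2.1.1 t.1, x.2.1.2 t.2))
  let l := ε / 4
  have hlow : ∀ h : V × V → W, Real.exp (l * (ε * K ^ 2)) ≤ ∑ x ∈ good, Real.exp (l * S x h) := by
    intro h
    obtain ⟨a, b, a', b', ha, hb, hne, T, hT⟩ := hbad h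
    have hmem : (((a, b), (a', b'), T) : P) ∈ good := by
      simp only [good, Finset.mem_filter, Finset.mem_univ, true_and]
      exact ⟨ha, hb, hne⟩
    refine le_trans ?_ (Finset.single_le_sum (fun x _ => (Real.exp_pos (l * S x h)).le) hmem)
    have : ε * K ^ 2 ≤ S ((a, b), (a', b'), T) h := by
      simp only [S, Fintype.sum_prod_type]
      exact hT.le
    have hl : 0 ≤ l := by positivity
    gcongr
  have hup : ∀ x ∈ good, ∑ h : V × V → W, Real.exp (l * S x h) ≤
      Fintype.card (V × V → W) * Real.exp (2 * l ^ 2 * K ^ 2) := by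
    intro x hx
    simp only [good, Finset.mem_filter, Finset.mem_univ, true_and] at hx
    obtain ⟨ha, hb, hne⟩ := hx
    have := sum_exp_le_of_ne (W := W) (centredIndicator x.2.2) (sum_centredIndicator _)
      (fun u w => (abs_centredIndicator_le _ u w).trans (by
        have : (0 : ℝ) ≤ (Fintype.card W : ℝ)⁻¹ := by positivity
        linarith))
      (fun t : Fin K × Fin K => (x.1.1 t.1, x.1.2 t.2))
      (fun t : Fin K × Fin K => (x.2.1.1 t.1, x.2.1.2 t.2)) (ha.prodMap hb)
      (fun t => hne t.1 t.2) l
    simpa [S, sq] using this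
  have hP : (good.card : ℝ) ≤ (Fintype.card V : ℝ) ^ (4 * K) * 2 ^ (Fintype.card W ^ 2) := by
    have h1 : good.card ≤ Fintype.card P := Finset.card_le_univ _
    have h2 : Fintype.card P = Fintype.card V ^ (4 * K) * 2 ^ (Fintype.card W ^ 2) := by
      simp only [P, Fintype.card_prod, Fintype.card_fun, Fintype.card_fin, Fintype.card_finset]
      ring
    rw [h2] at h1
    exact_mod_cast h1
  have hpos : 0 < (Fintype.card (V × V → W) : ℝ) := by exact_mod_cast Fintype.card_pos
  have hmain : (Fintype.card (V × V → W) : ℝ) * Real.exp (l * (ε * K ^ 2)) ≤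
      good.card * (Fintype.card (V × V → W) * Real.exp (2 * l ^ 2 * K ^ 2)) := by
    calc _ = ∑ h : V × V → W, Real.exp (l * (ε * K ^ 2)) := by simp
      _ ≤ ∑ h : V × V → W, ∑ x ∈ good, Real.exp (l * S x h) :=
          Finset.sum_le_sum fun h _ => hlow h
      _ = ∑ x ∈ good, ∑ h : V × V → W, Real.exp (l * S x h) := Finset.sum_comm
      _ ≤ ∑ x ∈ good, Fintype.card (V × V → W) * Real.exp (2 * l ^ 2 * K ^ 2) :=
          Finset.sum_le_sum hup
      _ = _ := by simp
  have hsplit : Real.exp (l * (ε * K ^ 2)) =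
      Real.exp (ε ^ 2 * K ^ 2 / 8) * Real.exp (2 * l ^ 2 * K ^ 2) := by
    rw [← Real.exp_add]; congr 1; simp only [l]; ring
  rw [hsplit] at hmain
  have hE := Real.exp_pos (2 * l ^ 2 * K ^ 2)
  have : Real.exp (ε ^ 2 * K ^ 2 / 8) ≤ good.card := by
    refine le_of_mul_le_mul_right ?_ (mul_pos hpos hE)
    linarith
  linarith

/-- A linear functional on distributions of min-entropy `log K` is dominated by its value on a
flat distribution on `K` points. -/
lemma exists_card_eq_sum_mul_le {V : Type*} [Fintype V] [DecidableEq V] {K : ℕ} (hK : 0 < K)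
    (p c : V → ℝ) (hp : ∀ x, 0 ≤ p x) (hpK : ∀ x, p x ≤ (K : ℝ)⁻¹) (hsum : ∑ x, p x = 1) :
    ∃ A : Finset V, A.card = K ∧ ∑ x, p x * c x ≤ (K : ℝ)⁻¹ * ∑ x ∈ A, c x := by
  have hK' : 0 < (K : ℝ) := by exact_mod_cast hK
  have hle : K ≤ Fintype.card V := by
    have : (1 : ℝ) ≤ Fintype.card V * (K : ℝ)⁻¹ := by
      rw [← hsum]
      calc _ ≤ ∑ _x : V, (K : ℝ)⁻¹ := Finset.sum_le_sum fun x _ => hpK x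
        _ = _ := by simp
    rw [← div_eq_mul_inv, le_div_iff₀ hK', one_mul] at this
    exact_mod_cast this
  have hne : ((Finset.univ : Finset V).powersetCard K).Nonempty :=
    Finset.powersetCard_nonempty.2 (by simpa using hle)
  obtain ⟨A, hA, hmax⟩ := Finset.exists_max_image _ (fun A => ∑ x ∈ A, c x) hne
  rw [Finset.mem_powersetCard] at hA
  have hAne : A.Nonempty := Finset.card_pos.1 (hA.2 ▸ hK)
  obtain ⟨y, hy, hmin⟩ := Finset.exists_min_image A c hAne
  have hout : ∀ x, x ∉ A → c x ≤ c y := by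
    intro x hx
    have hx' : x ∉ A.erase y := fun h => hx (Finset.mem_of_mem_erase h)
    have := hmax (insert x (A.erase y)) (by
      rw [Finset.mem_powersetCard]
      refine ⟨Finset.subset_univ _, ?_⟩
      rw [Finset.card_insert_of_notMem hx', Finset.card_erase_of_mem hy]
      omega)
    rw [Finset.sum_insert hx', ← Finset.add_sum_erase A c hy] at this
    linarith
  refine ⟨A, hA.2, ?_⟩
  have hkey : ∑ x, p x * (c x - c y) ≤ ∑ x ∈ A, (K : ℝ)⁻¹ * (c x - c y) := by
    rw [← Finset.sum_add_sum_compl A]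
    have h1 : ∑ x ∈ A, p x * (c x - c y) ≤ ∑ x ∈ A, (K : ℝ)⁻¹ * (c x - c y) :=
      Finset.sum_le_sum fun x hx =>
        mul_le_mul_of_nonneg_right (hpK x) (sub_nonneg.2 (hmin x hx))
    have h2 : ∑ x ∈ Aᶜ, p x * (c x - c y) ≤ 0 := Finset.sum_nonpos fun x hx =>
      mul_nonpos_of_nonneg_of_nonpos (hp x)
        (sub_nonpos.2 (hout x (Finset.mem_compl.1 hx)))
    linarith
  simp only [mul_sub, Finset.sum_sub_distrib, ← Finset.sum_mul, hsum, Finset.sum_const, hA.2,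
    nsmul_eq_mul] at hkey
  rw [mul_inv_cancel₀ hK'.ne', ← Finset.mul_sum] at hkey
  linarith

/-- Bilinear version of `exists_card_eq_sum_mul_le`. -/
lemma exists_injective_sum_sum_mul_le {V : Type*} [Fintype V] [DecidableEq V] {K : ℕ} (hK : 0 < K)
    (p q : V → ℝ) (c : V → V → ℝ) (hp : ∀ x, 0 ≤ p x) (hpK : ∀ x, p x ≤ (K : ℝ)⁻¹)
    (hpsum : ∑ x, p x = 1) (hq : ∀ x, 0 ≤ q x) (hqK : ∀ x, q x ≤ (K : ℝ)⁻¹)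
    (hqsum : ∑ x, q x = 1) :
    ∃ a b : Fin K → V, Function.Injective a ∧ Function.Injective b ∧
      ∑ x, ∑ y, p x * q y * c x y ≤ ((K : ℝ) ^ 2)⁻¹ * ∑ i, ∑ j, c (a i) (b j) := by
  obtain ⟨A, hA, hAle⟩ := exists_card_eq_sum_mul_le hK p (fun x => ∑ y, q y * c x y) hp hpK hpsum
  obtain ⟨B, hB, hBle⟩ := exists_card_eq_sum_mul_le hK q (fun y => ∑ x ∈ A, c x y) hq hqK hqsum
  let a := (Finset.equivFinOfCardEq hA).symm
  let b := (Finset.equivFinOfCardEq hB).symm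
  refine ⟨fun i => a i, fun j => b j, Subtype.val_injective.comp a.injective,
    Subtype.val_injective.comp b.injective, ?_⟩
  have hab : ∑ i, ∑ j, c (a i) (b j) = ∑ y ∈ B, ∑ x ∈ A, c x y := by
    rw [Finset.sum_comm, ← Finset.sum_coe_sort B, ← b.sum_comp]
    refine Finset.sum_congr rfl fun j _ => ?_
    rw [← Finset.sum_coe_sort A, ← a.sum_comp]
  rw [hab]
  calc ∑ x, ∑ y, p x * q y * c x y = ∑ x, p x * ∑ y, q y * c x y := by
        simp only [Finset.mul_sum, mul_assoc]
    _ ≤ (K : ℝ)⁻¹ * ∑ x ∈ A, ∑ y, q y * c x y := hAle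
    _ = (K : ℝ)⁻¹ * ∑ y, q y * ∑ x ∈ A, c x y := by
        rw [Finset.sum_comm]; simp only [Finset.mul_sum]
    _ ≤ (K : ℝ)⁻¹ * ((K : ℝ)⁻¹ * ∑ y ∈ B, ∑ x ∈ A, c x y) := by gcongr
    _ = _ := by rw [sq, mul_inv, mul_assoc]

section Distribution

variable {α β : Type*} [Fintype α] [Fintype β]

lemma sum_toReal_eq_one (p : PMF α) : ∑ x, (p x).toReal = 1 := by
  rw [← ENNReal.toReal_sum fun x _ => p.apply_ne_top x, ← tsum_fintype (L := .unconditional _),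
    p.tsum_coe, ENNReal.toReal_one]

lemma sum_toReal_map_mul (p : PMF α) (F : α → β) (g : β → ℝ) :
    ∑ b, (p.map F b).toReal * g b = ∑ a, (p a).toReal * g (F a) := by
  classical
  have h : ∀ b, (p.map F b).toReal = ∑ a, if b = F a then (p a).toReal else 0 := by
    intro b
    rw [PMF.map_apply, tsum_fintype, ENNReal.toReal_sum]
    · refine Finset.sum_congr rfl fun a _ => ?_
      split_ifs <;> simp
    · intro a _
      split_ifs <;> simp [p.apply_ne_top]
  simp only [h, Finset.sum_mul]
  rw [Finset.sum_comm]
  refine Finset.sum_congr rfl fun a _ => ?_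
  simp

lemma toReal_prodPMF_apply (p : PMF α) (q : PMF β) (x : α) (y : β) :
    (prodPMF p q (x, y)).toReal = (p x).toReal * (q y).toReal := by
  classical
  rw [← ENNReal.toReal_mul]
  congr 1
  simp only [prodPMF, PMF.bind_apply, PMF.map_apply, tsum_fintype, Prod.mk.injEq]
  rw [Finset.sum_eq_single x, Finset.sum_eq_single y]
  · simp
  · intro b _ hb; simp [hb.symm]
  · simp
  · intro b _ hb; simp [hb.symm]
  · simp

end Distribution

/-- The advantage of a test `T` as a bilinear form in the two sources. -/
lemma sum_tampered_sub_sum_uniform {V W : Type*} [Fintype V] [Fintype W] [DecidableEq W]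
    [Nonempty W] (pX pY : PMF V) (h : V → V → W) (f g : V → V) (T : Finset (W × W)) :
    ∑ z ∈ T, ((prodPMF pX pY).map (fun xy => (h xy.1 xy.2, h (f xy.1) (g xy.2))) z).toReal -
      ∑ z ∈ T, (prodPMF (PMF.uniformOfFintype W)
        ((prodPMF pX pY).map fun xy => h (f xy.1) (g xy.2)) z).toReal =
      ∑ x, ∑ y, (pX x).toReal * (pY y).toReal *
        centredIndicator T (h x y) (h (f x) (g y)) := by
  have hT : ∀ r : W × W → ℝ, ∑ z ∈ T, r z = ∑ z, r z * if z ∈ T then 1 else 0 := by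
    intro r; simp
  have hU : ∀ u : W, (PMF.uniformOfFintype W u).toReal = (Fintype.card W : ℝ)⁻¹ := by
    intro u; simp
  rw [hT, hT, sum_toReal_map_mul]
  have hQ : ∑ z, (prodPMF (PMF.uniformOfFintype W)
        ((prodPMF pX pY).map fun xy => h (f xy.1) (g xy.2)) z).toReal *
          (if z ∈ T then 1 else 0) =
      ∑ w, ((prodPMF pX pY).map (fun xy => h (f xy.1) (g xy.2)) w).toReal *
        ((Fintype.card W : ℝ)⁻¹ * ∑ u, if (u, w) ∈ T then 1 else 0) := by
    rw [Fintype.sum_prod_type, Finset.sum_comm]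
    refine Finset.sum_congr rfl fun w _ => ?_
    rw [Finset.mul_sum, Finset.mul_sum]
    refine Finset.sum_congr rfl fun u _ => ?_
    rw [toReal_prodPMF_apply, hU]
    ring
  rw [hQ, sum_toReal_map_mul, ← Finset.sum_sub_distrib, Fintype.sum_prod_type]
  refine Finset.sum_congr rfl fun x _ => Finset.sum_congr rfl fun y _ => ?_
  rw [toReal_prodPMF_apply, centredIndicator]
  ring

/-- It suffices to bound the one-sided advantage of every test. -/
lemma sd_tampered_le {V W : Type*} [Fintype V] [Fintype W] [DecidableEq W]
    [Nonempty W] (pX pY : PMF V) (h : V → V → W) (f g : V → V) (ε : ℝ)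
    (hε : ∀ T : Finset (W × W), ∑ x, ∑ y, (pX x).toReal * (pY y).toReal *
      centredIndicator T (h x y) (h (f x) (g y)) ≤ ε) :
    sd ((prodPMF pX pY).map fun xy => (h xy.1 xy.2, h (f xy.1) (g xy.2)))
      (prodPMF (PMF.uniformOfFintype W)
        ((prodPMF pX pY).map fun xy => h (f xy.1) (g xy.2))) ≤ ε := by
  refine ciSup_le fun T => ?_
  rw [sum_tampered_sub_sum_uniform, abs_le']
  refine ⟨hε T, ?_⟩
  have := hε Tᶜ
  simpa only [centredIndicator_compl, mul_neg, Finset.sum_neg_distrib] using this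

/-- Every function is an extractor with the trivial error `1 - 1 / |W|`. -/
lemma sd_tampered_le_one_sub_inv_card {V W : Type*} [Fintype V] [Fintype W] [DecidableEq W]
    [Nonempty W] (pX pY : PMF V) (h : V → V → W) (f g : V → V) :
    sd ((prodPMF pX pY).map fun xy => (h xy.1 xy.2, h (f xy.1) (g xy.2)))
      (prodPMF (PMF.uniformOfFintype W)
        ((prodPMF pX pY).map fun xy => h (f xy.1) (g xy.2))) ≤ 1 - (Fintype.card W : ℝ)⁻¹ := by
  refine sd_tampered_le pX pY h f g _ fun T => ?_
  calc _ ≤ ∑ x, ∑ y, (pX x).toReal * (pY y).toReal * (1 - (Fintype.card W : ℝ)⁻¹) := by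
        gcongr with x _ y _
        exact centredIndicator_le T _ _
    _ = _ := by
        simp only [← Finset.sum_mul, ← Finset.mul_sum, sum_toReal_eq_one, mul_one, one_mul]

/-- Existence of two-source non-malleable extractors for sources of min-entropy `log K`. -/
lemma exists_forall_sd_tampered_le {V W : Type*} [Fintype V] [DecidableEq V] [Fintype W]
    [DecidableEq W] [Nonempty W] (K : ℕ) (hK : 0 < K) (ε : ℝ)
    (hcard : (Fintype.card V : ℝ) ^ (4 * K) * 2 ^ (Fintype.card W ^ 2) <
      Real.exp (ε ^ 2 * K ^ 2 / 8)) (hε : 0 < ε) :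
    ∃ h : V → V → W, ∀ pX pY : PMF V,
      (∀ x, (pX x).toReal ≤ (K : ℝ)⁻¹) → (∀ y, (pY y).toReal ≤ (K : ℝ)⁻¹) →
      ∀ f g : V → V, ((∀ x, f x ≠ x) ∨ (∀ y, g y ≠ y)) →
        sd ((prodPMF pX pY).map fun xy => (h xy.1 xy.2, h (f xy.1) (g xy.2)))
          (prodPMF (PMF.uniformOfFintype W)
            ((prodPMF pX pY).map fun xy => h (f xy.1) (g xy.2))) ≤ ε := by
  obtain ⟨h, hh⟩ := exists_forall_sum_centredIndicator_le (V := V) (W := W) K ε hcard hε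
  refine ⟨fun x y => h (x, y), fun pX pY hX hY f g hfg => ?_⟩
  refine sd_tampered_le pX pY (fun x y => h (x, y)) f g ε fun T => ?_
  obtain ⟨a, b, ha, hb, hab⟩ := exists_injective_sum_sum_mul_le hK (fun x => (pX x).toReal)
    (fun y => (pY y).toReal) (fun x y => centredIndicator T (h (x, y)) (h (f x, g y)))
    (fun _ => ENNReal.toReal_nonneg) hX (sum_toReal_eq_one pX)
    (fun _ => ENNReal.toReal_nonneg) hY (sum_toReal_eq_one pY)
  refine hab.trans ?_
  have hne : ∀ i j, (a i, b j) ≠ (f (a i), g (b j)) := by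
    intro i j hij
    rw [Prod.mk.injEq] at hij
    rcases hfg with hf | hg
    · exact hf _ hij.1.symm
    · exact hg _ hij.2.symm
  have hKpos : 0 < (K : ℝ) ^ 2 := by positivity
  rw [inv_mul_le_iff₀ hKpos, mul_comm]
  exact hh a b (f ∘ a) (g ∘ b) ha hb hne T

/-- The counting condition for sources of min-entropy `⌊k / 2⌋`. -/
lemma card_pow_mul_two_pow_lt_exp (n : ℕ) (k : ℝ) (hn : 10 * Real.logb 2 n ≤ k) (hkn : k ≤ n)
    (hk : 100 < k) :
    ((2 : ℝ) ^ n) ^ (4 * 2 ^ ⌊k / 2⌋₊) * 2 ^ ((2 ^ ⌈k / 100⌉₊) ^ 2) <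
      Real.exp (((2 : ℝ) ^ (-(k / 100))) ^ 2 * (2 ^ ⌊k / 2⌋₊) ^ 2 / 8) := by
  set t := ⌊k / 2⌋₊
  set m := ⌈k / 100⌉₊
  set K : ℝ := 2 ^ t with hKdef
  set ε : ℝ := (2 : ℝ) ^ (-(k / 100)) with hεdef
  have hε2 : ε ^ 2 = (2 : ℝ) ^ (-(k / 50)) := by
    rw [hεdef, ← Real.rpow_natCast, ← Real.rpow_mul (by norm_num)]
    congr 1; push_cast; ring
  have hKlow : (2 : ℝ) ^ (k / 2 - 1) ≤ K := by
    rw [hKdef, ← Real.rpow_natCast]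
    exact Real.rpow_le_rpow_of_exponent_le (by norm_num) (Nat.sub_one_lt_floor _).le
  have hK0 : 0 < K := by positivity
  have hnle : (n : ℝ) ≤ (2 : ℝ) ^ (k / 10) := by
    rw [← Real.logb_le_iff_le_rpow (by norm_num) (by linarith)]
    linarith
  have hm : ((2 : ℝ) ^ m) ^ 2 ≤ (2 : ℝ) ^ (k / 50 + 2) := by
    rw [← pow_mul, ← Real.rpow_natCast]
    refine Real.rpow_le_rpow_of_exponent_le (by norm_num) ?_
    have := (Nat.ceil_lt_add_one (show 0 ≤ k / 100 by linarith)).le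
    push_cast
    linarith
  have h128 : (2 : ℝ) ^ (7 : ℝ) = 128 := by
    rw [show (7 : ℝ) = (7 : ℕ) by norm_num, Real.rpow_natCast]; norm_num
  have hnK : 128 * (n : ℝ) ≤ ε ^ 2 * K := by
    calc 128 * (n : ℝ) ≤ (2 : ℝ) ^ (7 : ℝ) * (2 : ℝ) ^ (k / 10) := by rw [h128]; gcongr
      _ = (2 : ℝ) ^ (7 + k / 10) := by rw [Real.rpow_add (by norm_num)]
      _ ≤ (2 : ℝ) ^ (-(k / 50) + (k / 2 - 1)) :=
          Real.rpow_le_rpow_of_exponent_le (by norm_num) (by linarith)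
      _ = ε ^ 2 * (2 : ℝ) ^ (k / 2 - 1) := by rw [Real.rpow_add (by norm_num), hε2]
      _ ≤ _ := by gcongr
  have hmK : 128 * ((2 : ℝ) ^ m) ^ 2 ≤ ε ^ 2 * K ^ 2 := by
    calc 128 * ((2 : ℝ) ^ m) ^ 2 ≤ (2 : ℝ) ^ (7 : ℝ) * (2 : ℝ) ^ (k / 50 + 2) := by
          rw [h128]; gcongr
      _ = (2 : ℝ) ^ (7 + (k / 50 + 2)) := by rw [Real.rpow_add (by norm_num) 7]
      _ ≤ (2 : ℝ) ^ (-(k / 50) + ((k / 2 - 1) + (k / 2 - 1))) :=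
          Real.rpow_le_rpow_of_exponent_le (by norm_num) (by linarith)
      _ = ε ^ 2 * ((2 : ℝ) ^ (k / 2 - 1)) ^ 2 := by
          rw [Real.rpow_add (by norm_num), Real.rpow_add (by norm_num) (k / 2 - 1), hε2, sq]
      _ ≤ _ := by gcongr
  have hexp : ∀ N : ℕ, (2 : ℝ) ^ N ≤ Real.exp N := by
    intro N
    rw [← Real.exp_one_pow]
    have := Real.add_one_le_exp (1 : ℝ)
    gcongr
    linarith
  rw [← pow_mul, ← pow_add]
  refine (hexp _).trans_lt (Real.exp_lt_exp.2 ?_)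
  push_cast
  rw [← hKdef]
  have h1 := mul_le_mul_of_nonneg_right hnK hK0.le
  have h2 : 0 < ε ^ 2 * K ^ 2 := by positivity
  nlinarith

/-- There exists a constant `C > 1` such that for every constant `0 < γ < 1` there is a
constant `α > 0` such that for every `n` and every `k` with `C log₂ n ≤ k ≤ n` there is
a `((2/3+γ)n, k, 2^{-αk})` two-source non-malleable extractor with output length
`m ≥ α k`: for all independent sources `X`, `Y` with `H∞(X) ≥ (2/3+γ)n`, `H∞(Y) ≥ k`
and all tampering functions `f`, `g` such that `f` or `g` has no fixed points,
`Δ((nmExt(X,Y), nmExt(f(X),g(Y))), (U_m, nmExt(f(X),g(Y)))) ≤ 2^{-αk}`. -/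
theorem stmt_8 :
    ∃ C : ℝ, C > 1 ∧
      ∀ γ : ℝ, 0 < γ → γ < 1 →
        ∃ α : ℝ, α > 0 ∧
          ∀ n : ℕ, ∀ k : ℝ, C * Real.logb 2 n ≤ k → k ≤ n →
            ∃ m : ℕ, (m : ℝ) ≥ α * k ∧
              ∃ nmExt : Bits n → Bits n → Bits m,
                ∀ pX pY : PMF (Bits n),
                  minEntropyGe pX ((2 / 3 + γ) * n) → minEntropyGe pY k →
                  ∀ f g : Bits n → Bits n,
                    ((∀ x, f x ≠ x) ∨ (∀ y, g y ≠ y)) →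
                    sd ((prodPMF pX pY).map
                          fun xy => (nmExt xy.1 xy.2, nmExt (f xy.1) (g xy.2)))
                       (prodPMF (PMF.uniformOfFintype (Bits m))
                         ((prodPMF pX pY).map fun xy => nmExt (f xy.1) (g xy.2)))
                      ≤ (2 : ℝ) ^ (-(α * k)) := by
  refine ⟨10, by norm_num, fun γ hγ _ => ⟨1 / 100, by norm_num, fun n k hn hkn => ?_⟩⟩
  rcases le_or_gt k 100 with hk | hk
  · refine ⟨1, by norm_num; linarith, fun _ _ _ => false, fun pX pY _ _ f g _ => ?_⟩
    refine (sd_tampered_le_one_sub_inv_card (W := Bits 1) pX pY (fun _ _ _ => false) f g).trans ?_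
    calc 1 - (Fintype.card (Bits 1) : ℝ)⁻¹ = (2 : ℝ) ^ (-1 : ℝ) := by
          norm_num [Real.rpow_neg_one]
      _ ≤ _ := Real.rpow_le_rpow_of_exponent_le (by norm_num) (by linarith)
  · refine ⟨⌈k / 100⌉₊, ?_, ?_⟩
    · have := Nat.le_ceil (k / 100)
      linarith
    obtain ⟨h, hh⟩ := exists_forall_sd_tampered_le (V := Bits n) (W := Bits ⌈k / 100⌉₊)
      (2 ^ ⌊k / 2⌋₊) (by positivity) ((2 : ℝ) ^ (-(k / 100)))
      (by
        simp only [Fintype.card_fun, Fintype.card_bool, Fintype.card_fin, Nat.cast_pow,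
          Nat.cast_ofNat]
        exact card_pow_mul_two_pow_lt_exp n k hn hkn hk) (by positivity)
    have hentropy : ∀ (p : PMF (Bits n)) (s : ℝ), k / 2 ≤ s → minEntropyGe p s →
        ∀ x, (p x).toReal ≤ ((2 ^ ⌊k / 2⌋₊ : ℕ) : ℝ)⁻¹ := by
      intro p s hs hp x
      refine (hp x).trans ?_
      push_cast
      rw [← Real.rpow_natCast, ← Real.rpow_neg (by norm_num)]
      refine Real.rpow_le_rpow_of_exponent_le (by norm_num) ?_
      have := Nat.floor_le (show 0 ≤ k / 2 by linarith)
      linarith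
    refine ⟨h, fun pX pY hX hY f g hfg => ?_⟩
    have := hh pX pY (hentropy pX _ (by nlinarith) hX) (hentropy pY _ (by linarith) hY) f g hfg
    rwa [one_div_mul_eq_div]
end

section
/- There exist constants ρ>0 and α>0 such that for every n∈ℕ there exist k ≥ ρ·2n, a randomized encoding function E : {0,1}^k → {0,1}^n × {0,1}^n, and a deterministic decoding function D : {0,1}^n × {0,1}^n → {0,1}^k, such that D(E(x)) = x with probability 1 for every message x, and for every pair of tampering functions h₁, h₂ : {0,1}^n → {0,1}^n there exists a probability distribution G over NM_k such that for every x ∈ {0,1}^k, Δ(D(h₁(L), h₂(R)), G(x)) ≤ 2^{−αk}, where (L,R) = E(x) and G(x) denotes the distribution obtained by sampling g from G and outputting g(x). (Efficiency of E and D is omitted; only existence is asserted.) -/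
/-!
The set `NM_k` of trivial manipulation functions on `k`-bit strings (the identity and
all constant functions) is modeled by `Option (Bits k)`: `none` is the identity and
`some c` is the constant function with value `c`.  Applying `g : Option (Bits k)` to a
message `x` is `g.getD x`.  A distribution `G` over `NM_k` is a `PMF (Option (Bits k))`,
and `G(x)` is `G.map (fun g => g.getD x)`.
-/

/-- Averaging over the value of one coordinate does not change the sum over all functions. -/
lemma card_mul_sum_eq_sum_update {V B : Type*} [Fintype V] [DecidableEq V] [Fintype B]
    (c : V) (f : (V → B) → ℝ) :
    (Fintype.card B : ℝ) * ∑ D, f D = ∑ D, ∑ d, f (Function.update D c d) := by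
  have hσ : Function.Involutive
      (fun p : (V → B) × B => (Function.update p.1 c p.2, p.1 c)) := by
    rintro ⟨D, d⟩
    simp
  have h := Equiv.sum_comp hσ.toPerm (fun p : (V → B) × B => f p.1)
  simp only [Fintype.sum_prod_type, Function.Involutive.coe_toPerm] at h
  rw [h, Finset.mul_sum]
  simp

lemma sum_exp_mul_le_s11 {B : Type*} [Fintype B] {a : B → ℝ} {l w : ℝ} (ha : ∑ d, a d = 0)
    (hal : ∀ d, |a d| ≤ l) (hl : l ≤ 1) (hw : |w| ≤ 1) :
    ∑ d, Real.exp (a d * w) ≤ Fintype.card B * Real.exp (l ^ 2) := by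
  have key : ∀ d, Real.exp (a d * w) ≤ a d * w + Real.exp (l ^ 2) := by
    intro d
    have h1 : |a d * w| ≤ l := by
      rw [abs_mul]
      nlinarith [abs_nonneg (a d), abs_nonneg w, hal d]
    have h2 := (abs_le.mp (Real.abs_exp_sub_one_sub_id_le (h1.trans hl))).2
    have h3 : (a d * w) ^ 2 ≤ l ^ 2 := sq_le_sq' (abs_le.mp h1).1 (abs_le.mp h1).2
    have h4 := Real.add_one_le_exp (l ^ 2)
    linarith
  calc ∑ d, Real.exp (a d * w) ≤ ∑ d, (a d * w + Real.exp (l ^ 2)) :=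
        Finset.sum_le_sum fun d _ => key d
    _ = _ := by
        rw [Finset.sum_add_distrib, ← Finset.sum_mul, ha]
        simp

/-- Exponential moment bound for a sum of bounded martingale differences: the weight `w c` does not
depend on the coordinates whose rank is at least the rank of `c`. -/
lemma sum_exp_predictable_le {V B : Type*} [Fintype V] [DecidableEq V] [Fintype B] [Nonempty B]
    {a : B → ℝ} {l : ℝ} (ha : ∑ d, a d = 0) (hal : ∀ d, |a d| ≤ l) (hl : l ≤ 1)
    (w : V → (V → B) → ℝ) (hw : ∀ c D, |w c D| ≤ 1) (r : V → ℤ) (A : Finset V)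
    (hwr : ∀ c ∈ A, ∀ c', r c ≤ r c' → ∀ D d, w c (Function.update D c' d) = w c D) :
    ∑ D : V → B, Real.exp (∑ c ∈ A, a (D c) * w c D) ≤
      Fintype.card (V → B) * Real.exp (l ^ 2) ^ A.card := by
  induction A using Finset.induction_on_max_value r with
  | empty => simp
  | insert c₀ A hc₀ hmax ih =>
    have hB : (0 : ℝ) < Fintype.card B := by exact_mod_cast Fintype.card_pos
    have ih' := ih fun c hc => hwr c (Finset.mem_insert_of_mem hc)
    rw [Finset.card_insert_of_notMem hc₀, pow_succ, ← mul_assoc]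
    refine le_trans ?_ (mul_le_mul_of_nonneg_right ih' (Real.exp_pos _).le)
    refine le_of_mul_le_mul_left ?_ hB
    rw [card_mul_sum_eq_sum_update c₀]
    have hinner : ∀ D : V → B, ∑ d, Real.exp (∑ c ∈ insert c₀ A,
        a (Function.update D c₀ d c) * w c (Function.update D c₀ d)) =
        Real.exp (∑ c ∈ A, a (D c) * w c D) * ∑ d, Real.exp (a d * w c₀ D) := by
      intro D
      rw [Finset.mul_sum]
      refine Finset.sum_congr rfl fun d _ => ?_
      rw [Finset.sum_insert hc₀, Real.exp_add, mul_comm]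
      congr 2
      · refine Finset.sum_congr rfl fun c hc => ?_
        rw [Function.update_of_ne (ne_of_mem_of_not_mem hc hc₀),
          hwr c (Finset.mem_insert_of_mem hc) c₀ (hmax c hc)]
      · rw [Function.update_self, hwr c₀ (Finset.mem_insert_self _ _) c₀ le_rfl]
    simp only [hinner]
    rw [Finset.sum_mul, Finset.mul_sum]
    refine Finset.sum_le_sum fun D _ => ?_
    have := mul_le_mul_of_nonneg_left (sum_exp_mul_le_s11 ha hal hl (hw c₀ D))
      (Real.exp_pos (∑ c ∈ A, a (D c) * w c D)).le
    linarith

lemma exists_forall_le_of_sum_exp_le {Ω J : Type*} [Fintype Ω] [Nonempty Ω] [Fintype J]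
    (Z : J → Ω → ℝ) {M t : ℝ} (hZ : ∀ j, ∑ ω, Real.exp (Z j ω) ≤ Fintype.card Ω * M)
    (hM : Fintype.card J * M < Real.exp t) : ∃ ω, ∀ j, Z j ω ≤ t := by
  by_contra! hcon
  have h1 : ∀ ω, Real.exp t ≤ ∑ j, Real.exp (Z j ω) := by
    intro ω
    obtain ⟨j, hj⟩ := hcon ω
    exact (Real.exp_le_exp.mpr hj.le).trans
      (Finset.single_le_sum (f := fun j => Real.exp (Z j ω))
        (fun j _ => (Real.exp_pos _).le) (Finset.mem_univ j))
  have h2 : (Fintype.card Ω : ℝ) * Real.exp t ≤ ∑ ω, ∑ j, Real.exp (Z j ω) := by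
    have := Finset.sum_le_sum fun ω (_ : ω ∈ Finset.univ) => h1 ω
    simpa using this
  rw [Finset.sum_comm] at h2
  have h3 : ∑ j, ∑ ω, Real.exp (Z j ω) ≤ Fintype.card J * (Fintype.card Ω * M) := by
    have := Finset.sum_le_sum fun j (_ : j ∈ Finset.univ) => hZ j
    simpa using this
  have hΩ : (0 : ℝ) < Fintype.card Ω := by exact_mod_cast Fintype.card_pos
  nlinarith

/-- Indicator that the tampered message, computed with `x` in place of the decoding of a fixed point
of `h`, lies in `T`. -/
def tamperedIndicator {V B : Type*} [DecidableEq V] [DecidableEq B] (h : V → V) (x : B)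
    (T : Finset B) (c : V) (D : V → B) : ℝ :=
  if (if h c = c then x else D (h c)) ∈ T then 1 else 0

/-- For a random decoder `D`, the event `D c = x` is nearly uncorrelated with the outcome of
tampering, simultaneously for all members `H i` of a small family of tampering functions. -/
lemma exists_decoder {V B ι : Type*} [Fintype V] [DecidableEq V] [Fintype B] [DecidableEq B]
    [Nonempty B] [Fintype ι] (H : ι → V → V) {δ : ℝ} (hδ : 0 < δ) (hδ1 : δ ≤ 1)
    (hcard : (Fintype.card B * (2 ^ Fintype.card B * (Fintype.card ι * (3 * 2))) : ℝ) <
      Real.exp (Fintype.card V * δ ^ 2 / 36)) :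
    ∃ D : V → B, ∀ (x : B) (T : Finset B) (i : ι),
      |∑ c, ((if D c = x then 1 else 0) - 1 / (Fintype.card B : ℝ)) *
        tamperedIndicator (H i) x T c D| ≤ δ * Fintype.card V := by
  have hB : (1 : ℝ) ≤ Fintype.card B := by exact_mod_cast Fintype.card_pos
  let r : V → ℤ := fun c => (Fintype.equivFin V c : ℕ)
  have hr : Function.Injective r := fun c c' hcc =>
    (Fintype.equivFin V).injective (Fin.ext (Int.ofNat.inj hcc))
  let A : ι → SignType → Finset V := fun i σ =>
    Finset.univ.filter fun c => SignType.sign (r (H i c) - r c) = σ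
  let a : B → B → ℝ := fun x d => (if d = x then 1 else 0) - 1 / (Fintype.card B : ℝ)
  have ha : ∀ x, ∑ d, a x d = 0 := by
    intro x
    have : (Fintype.card B : ℝ) ≠ 0 := by positivity
    simp [a, Finset.sum_sub_distrib, this]
  have ha1 : ∀ x d, |a x d| ≤ 1 := by
    intro x d
    have h0 : 0 ≤ 1 / (Fintype.card B : ℝ) := by positivity
    have h1 : 1 / (Fintype.card B : ℝ) ≤ 1 := by
      rw [div_le_one (by positivity)]; exact hB
    simp only [a]
    rw [abs_le]
    split_ifs <;> constructor <;> linarith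
  let S : B × Finset B × ι × SignType → (V → B) → ℝ := fun j D =>
    ∑ c ∈ A j.2.2.1 j.2.2.2, a j.1 (D c) * tamperedIndicator (H j.2.2.1) j.1 j.2.1 c D
  obtain ⟨D, hD⟩ : ∃ D : V → B, ∀ j : B × Finset B × ι × SignType × Bool,
      (if j.2.2.2.2 then (1 : ℝ) else -1) * (δ / 6) *
        S (j.1, j.2.1, j.2.2.1, j.2.2.2.1) D ≤ δ ^ 2 / 18 * Fintype.card V := by
    refine exists_forall_le_of_sum_exp_le
      (M := Real.exp ((δ / 6) ^ 2) ^ Fintype.card V) _ ?_ ?_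
    · rintro ⟨x, T, i, σ, s⟩
      have h := sum_exp_predictable_le (V := V)
        (a := fun d => (if s then (1 : ℝ) else -1) * (δ / 6) * a x d) (l := δ / 6) ?_ ?_ ?_
        (fun c D => tamperedIndicator (H i) x T c D) ?_ (fun c => -(σ : ℤ) * r c) (A i σ) ?_
      · refine le_trans (le_of_eq ?_) (h.trans ?_)
        · refine Finset.sum_congr rfl fun D _ => ?_
          simp only [S, Finset.mul_sum, mul_assoc]
        · gcongr
          · exact Real.one_le_exp (by positivity)
          · exact Finset.card_le_univ _
      · rw [← Finset.mul_sum, ha, mul_zero]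
      · intro d
        have : |(if s then (1 : ℝ) else -1)| = 1 := by split_ifs <;> simp
        rw [abs_mul, abs_mul, this, one_mul, abs_of_pos (by positivity : 0 < δ / 6)]
        exact mul_le_of_le_one_right (by positivity) (ha1 x d)
      · linarith
      · intro c D
        unfold tamperedIndicator
        split_ifs <;> simp
      · intro c hc c' hcc' D d
        have hc : SignType.sign (r (H i c) - r c) = σ := by simpa [A] using hc
        unfold tamperedIndicator
        by_cases hfix : H i c = c
        · simp [hfix]
        · have hne : H i c ≠ c' := by
            rintro rfl
            rcases lt_trichotomy (r (H i c)) (r c) with hlt | heq | hgt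
            · rw [sign_neg (by linarith)] at hc
              subst hc
              simp at hcc'
              omega
            · exact hfix (hr heq)
            · rw [sign_pos (by linarith)] at hc
              subst hc
              simp at hcc'
              omega
          simp [hfix, Function.update_of_ne hne]
    · have hJ : (Fintype.card (B × Finset B × ι × SignType × Bool) : ℝ) =
          (Fintype.card B * (2 ^ Fintype.card B * (Fintype.card ι * (3 * 2))) : ℝ) := by
        have : Fintype.card SignType = 3 := rfl
        simp only [Fintype.card_prod, Fintype.card_finset, Fintype.card_bool, this]
        push_cast
        norm_num
      rw [hJ, ← Real.exp_nat_mul]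
      calc _ < Real.exp (Fintype.card V * δ ^ 2 / 36) *
              Real.exp (Fintype.card V * (δ / 6) ^ 2) := by gcongr
        _ = _ := by
            rw [← Real.exp_add]
            congr 1
            ring
  refine ⟨D, fun x T i => ?_⟩
  have hpiece : ∀ σ, |S (x, T, i, σ) D| ≤ δ / 3 * Fintype.card V := by
    intro σ
    have h1 := hD (x, T, i, σ, true)
    have h2 := hD (x, T, i, σ, false)
    simp only [if_true, Bool.false_eq_true, if_false] at h1 h2
    rw [abs_le]
    constructor <;> refine le_of_mul_le_mul_left ?_ (by positivity : 0 < δ / 6) <;> nlinarith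
  have hsum : ∑ c, a x (D c) * tamperedIndicator (H i) x T c D = ∑ σ, S (x, T, i, σ) D :=
    (Finset.sum_fiberwise Finset.univ (fun c => SignType.sign (r (H i c) - r c))
      fun c => a x (D c) * tamperedIndicator (H i) x T c D).symm
  calc _ = |∑ σ, S (x, T, i, σ) D| := by rw [← hsum]
    _ ≤ ∑ σ, |S (x, T, i, σ) D| := Finset.abs_sum_le_sum_abs _ _
    _ ≤ ∑ σ : SignType, δ / 3 * Fintype.card V := Finset.sum_le_sum fun σ _ => hpiece σ
    _ = δ * Fintype.card V := by
        have : Fintype.card SignType = 3 := rfl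
        simp [this]
        ring

lemma sum_toReal_uniformOfFinset_map {V B : Type*} [DecidableEq B] (S : Finset V)
    (hS : S.Nonempty) (f : V → B) (T : Finset B) :
    ∑ y ∈ T, (((PMF.uniformOfFinset S hS).map f) y).toReal =
      (S.filter fun c => f c ∈ T).card / (S.card : ℝ) := by
  classical
  rw [← ENNReal.toReal_sum fun y _ => PMF.apply_ne_top _ _, ← PMF.toOuterMeasure_apply_finset,
    PMF.toOuterMeasure_map_apply, PMF.toOuterMeasure_uniformOfFinset_apply]
  simp

/-- If `D c = x` is nearly uncorrelated with the outcome of tampering by `h`, then the uniform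
encoder of `D` is non-malleable with respect to `h`. -/
lemma exists_simulator {V : Type*} [Fintype V] [Nonempty V] [DecidableEq V] {k : ℕ}
    (D : V → Bits k) (h : V → V)
    (hD : ∀ (x : Bits k) (T : Finset (Bits k)),
      |∑ c, ((if D c = x then 1 else 0) - 1 / (2 ^ k : ℝ)) * tamperedIndicator h x T c D| ≤
        1 / (4 * (2 ^ k) ^ 2) * Fintype.card V)
    (hne : ∀ x, (Finset.univ.filter fun c => D c = x).Nonempty) :
    ∃ G : PMF (Option (Bits k)), ∀ x : Bits k,
      sd ((PMF.uniformOfFinset _ (hne x)).map fun c => D (h c)) (G.map fun g => g.getD x) ≤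
        1 / 2 ^ k := by
  refine ⟨(PMF.uniformOfFinset Finset.univ Finset.univ_nonempty).map
    (fun c => if h c = c then none else some (D (h c))), fun x => ciSup_le fun T => ?_⟩
  rw [PMF.map_comp, sum_toReal_uniformOfFinset_map, sum_toReal_uniformOfFinset_map]
  set K : ℝ := 2 ^ k
  have hK : 1 ≤ K := one_le_pow₀ (by norm_num)
  set n : ℝ := ((Finset.univ : Finset V).card : ℝ) with hn
  have hn0 : 0 < n := by rw [hn]; exact_mod_cast Finset.card_pos.mpr Finset.univ_nonempty
  set m : ℝ := ((Finset.univ.filter fun c => D c = x).card : ℝ) with hm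
  set s : ℝ := (((Finset.univ.filter fun c => D c = x).filter
    fun c => D (h c) ∈ T).card : ℝ)
  set W : ℝ := ((Finset.univ.filter fun c => ((fun g : Option (Bits k) => g.getD x) ∘
    fun c => if h c = c then none else some (D (h c))) c ∈ T).card : ℝ) with hW
  have hgen : ∀ T, ∑ c, ((if D c = x then 1 else 0) - 1 / K) * tamperedIndicator h x T c D =
      (((Finset.univ.filter fun c => D c = x).filter fun c => D (h c) ∈ T).card : ℝ) -
      (Finset.univ.filter fun c => ((fun g : Option (Bits k) => g.getD x) ∘
        fun c => if h c = c then none else some (D (h c))) c ∈ T).card / K := by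
    intro T
    rw [Finset.filter_filter, Finset.card_filter, Finset.card_filter]
    push_cast
    rw [Finset.sum_div, ← Finset.sum_sub_distrib]
    refine Finset.sum_congr rfl fun c _ => ?_
    unfold tamperedIndicator
    by_cases h1 : h c = c <;> by_cases h2 : D c = x <;> simp [h1, h2] <;> split_ifs <;> simp
  have hST := hD x T
  have hmn := hD x Finset.univ
  rw [hgen] at hST hmn
  simp only [Finset.mem_univ, Finset.filter_true] at hmn
  rw [← Finset.card_univ] at hST hmn
  change |s - W / K| ≤ 1 / (4 * K ^ 2) * n at hST
  change |m - n / K| ≤ 1 / (4 * K ^ 2) * n at hmn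
  have hW0 : 0 ≤ W := Nat.cast_nonneg _
  have hWn : W ≤ n := by
    rw [hW, hn]; exact_mod_cast Finset.card_le_card (Finset.filter_subset _ _)
  have hm0 : 0 < m := by rw [hm]; exact_mod_cast Finset.card_pos.mpr (hne x)
  have hmK : n / (2 * K) ≤ m := by
    have h1 := (abs_le.mp hmn).1
    have h2 : 1 / (4 * K ^ 2) * n ≤ n / (2 * K) := by
      rw [div_mul_eq_mul_div, one_mul]
      exact div_le_div_of_nonneg_left hn0.le (by positivity) (by nlinarith)
    have h3 : n / K = n / (2 * K) + n / (2 * K) := by field_simp; ring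
    linarith
  have hid : s / m - W / n = ((s - W / K) - W / n * (m - n / K)) / m := by
    field_simp
    ring
  rw [hid, abs_div, abs_of_pos hm0, div_le_iff₀ hm0]
  have hq : |W / n| ≤ 1 := by
    rw [abs_of_nonneg (by positivity), div_le_one hn0]; exact hWn
  calc |(s - W / K) - W / n * (m - n / K)| ≤ |s - W / K| + |W / n * (m - n / K)| := abs_sub _ _
    _ ≤ 1 / (4 * K ^ 2) * n + 1 * (1 / (4 * K ^ 2) * n) := by
        rw [abs_mul]
        gcongr
    _ = 1 / K * (n / (2 * K)) := by field_simp; ring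
    _ ≤ 1 / K * m := by gcongr

lemma card_bound {n k : ℕ} (hn : 48 ≤ n) (hk : k = n / 8) :
    ((2 ^ k : ℕ) * (2 ^ (2 ^ k) * (((2 ^ n) ^ (2 ^ n) * (2 ^ n) ^ (2 ^ n) : ℕ) * (3 * 2))) : ℝ) <
      Real.exp ((2 ^ n * 2 ^ n : ℕ) * (1 / (4 * (2 ^ k) ^ 2) : ℝ) ^ 2 / 36) := by
  have hpow : 2304 * n * (2 ^ k) ^ 4 ≤ 2 ^ n := by
    have h1 : ∀ m, 24 ≤ m → 2304 * (2 * m + 1) ≤ 2 ^ m := by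
      intro m hm
      induction m, hm using Nat.le_induction with
      | base => norm_num
      | succ m hm ih => rw [pow_succ]; omega
    have h2 := h1 (n / 2) (by omega)
    calc 2304 * n * (2 ^ k) ^ 4 ≤ 2304 * (2 * (n / 2) + 1) * 2 ^ (4 * k) := by
          rw [← pow_mul, mul_comm k 4]
          gcongr
          omega
      _ ≤ 2 ^ (n / 2) * 2 ^ (4 * k) := by gcongr
      _ = 2 ^ (n / 2 + 4 * k) := (pow_add _ _ _).symm
      _ ≤ 2 ^ n := Nat.pow_le_pow_right (by norm_num) (by omega)
  have hcount : (2 ^ k) * (2 ^ (2 ^ k) * (((2 ^ n) ^ (2 ^ n) * (2 ^ n) ^ (2 ^ n)) * (3 * 2))) ≤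
      2 ^ (4 * (n * 2 ^ n)) := by
    have hkn : 2 ^ k ≤ 2 ^ n := Nat.pow_le_pow_right (by norm_num) (by omega)
    have hnn : n < 2 ^ n := Nat.lt_two_pow_self
    calc _ ≤ 2 ^ k * (2 ^ (2 ^ k) * (((2 ^ n) ^ (2 ^ n) * (2 ^ n) ^ (2 ^ n)) * 2 ^ 3)) := by
          gcongr
          norm_num
      _ = 2 ^ (k + (2 ^ k + (n * 2 ^ n + n * 2 ^ n + 3))) := by
          simp only [← pow_mul, ← pow_add]
      _ ≤ _ := by
          refine Nat.pow_le_pow_right (by norm_num) ?_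
          have : 48 * 2 ^ n ≤ n * 2 ^ n := Nat.mul_le_mul_right _ hn
          omega
  have hcount' : ((2 ^ k : ℕ) * (2 ^ (2 ^ k) *
      (((2 ^ n) ^ (2 ^ n) * (2 ^ n) ^ (2 ^ n) : ℕ) * (3 * 2))) : ℝ) ≤
      2 ^ (4 * (n * 2 ^ n)) := by exact_mod_cast hcount
  refine hcount'.trans_lt ?_
  have h2e : (2 : ℝ) < Real.exp 1 := by linarith [Real.exp_one_gt_d9]
  have hne : 4 * (n * 2 ^ n) ≠ 0 := by positivity
  calc (2 : ℝ) ^ (4 * (n * 2 ^ n)) < Real.exp 1 ^ (4 * (n * 2 ^ n)) :=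
        pow_lt_pow_left₀ h2e (by norm_num) hne
    _ = Real.exp ((4 * (n * 2 ^ n) : ℕ) : ℝ) := by rw [← Real.exp_nat_mul, mul_one]
    _ ≤ _ := by
        rw [Real.exp_le_exp]
        have hpow' : (2304 * n * (2 ^ k) ^ 4 : ℝ) ≤ 2 ^ n := by exact_mod_cast hpow
        have hK : (0 : ℝ) < 2 ^ k := by positivity
        have hN : (0 : ℝ) < 2 ^ n := by positivity
        push_cast
        generalize (2 : ℝ) ^ k = K at *
        generalize (2 : ℝ) ^ n = N at *
        have : N * N * (1 / (4 * K ^ 2)) ^ 2 / 36 = N * N / (576 * K ^ 4) := by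
          field_simp
          norm_num
        rw [this, le_div_iff₀ (by positivity)]
        nlinarith

lemma sum_toReal_le_one {α : Type*} (p : PMF α) (T : Finset α) :
    ∑ x ∈ T, (p x).toReal ≤ 1 := by
  rw [← ENNReal.toReal_sum fun y _ => PMF.apply_ne_top _ _]
  refine ENNReal.toReal_le_of_le_ofReal zero_le_one ?_
  rw [ENNReal.ofReal_one, ← p.tsum_coe]
  exact ENNReal.sum_le_tsum T

lemma sd_le_one {α : Type*} [Fintype α] (p q : PMF α) : sd p q ≤ 1 := by
  refine ciSup_le fun T => ?_
  have hp := sum_toReal_le_one p T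
  have hq := sum_toReal_le_one q T
  have hp0 : 0 ≤ ∑ x ∈ T, (p x).toReal := Finset.sum_nonneg fun _ _ => ENNReal.toReal_nonneg
  have hq0 : 0 ≤ ∑ x ∈ T, (q x).toReal := Finset.sum_nonneg fun _ _ => ENNReal.toReal_nonneg
  rw [abs_le]
  constructor <;> linarith

lemma sum_toReal_univ {α : Type*} [Fintype α] (p : PMF α) : ∑ x, (p x).toReal = 1 := by
  rw [← ENNReal.toReal_sum fun y _ => PMF.apply_ne_top _ _, ← tsum_fintype (L := .unconditional _),
    p.tsum_coe, ENNReal.toReal_one]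

lemma sd_uniform_bits_one_le (p : PMF (Bits 1)) :
    sd p (PMF.uniformOfFintype (Bits 1)) ≤ 1 / 2 := by
  refine ciSup_le fun T => ?_
  have hp := sum_toReal_le_one p T
  have hp0 : 0 ≤ ∑ x ∈ T, (p x).toReal := Finset.sum_nonneg fun _ _ => ENNReal.toReal_nonneg
  have hq : ∑ x ∈ T, (PMF.uniformOfFintype (Bits 1) x).toReal = T.card / 2 := by
    simp [div_eq_mul_inv]
  have hT : T.card ≤ 2 := (Finset.card_le_univ T).trans (by simp)
  rw [hq]
  obtain h | h | h : T.card = 0 ∨ T.card = 1 ∨ T.card = 2 := by omega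
  · rw [Finset.card_eq_zero.mp h]
    norm_num
  · rw [h, abs_le]
    constructor <;> push_cast <;> linarith
  · have hu : T = Finset.univ := Finset.card_eq_iff_eq_univ T |>.mp (by simp [h])
    rw [h, hu, sum_toReal_univ]
    norm_num

lemma uniformOfFinset_fiber_map {V B : Type*} [Fintype V] [DecidableEq B] (D : V → B) (x : B)
    (hne : (Finset.univ.filter fun c => D c = x).Nonempty) :
    (PMF.uniformOfFinset _ hne).map D = PMF.pure x := by
  have hsupp : ((PMF.uniformOfFinset _ hne).map D).support = {x} := by
    ext y
    simp only [PMF.mem_support_map_iff, PMF.mem_support_uniformOfFinset_iff, Finset.mem_filter,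
      Finset.mem_univ, true_and, Set.mem_singleton_iff]
    constructor
    · rintro ⟨c, hc, rfl⟩
      exact hc
    · rintro rfl
      obtain ⟨c, hc⟩ := hne
      exact ⟨c, by simpa using hc, by simpa using hc⟩
  ext y
  by_cases hy : y = x
  · rw [hy, (PMF.apply_eq_one_iff _ _).mpr hsupp]
    simp
  · rw [(PMF.apply_eq_zero_iff _ _).mpr (by simpa [hsupp] using hy)]
    simp [hy]

/-- Non-malleable codes against 2-split-state tampering with constant rate and
exponentially small error: there exist `ρ > 0` and `α > 0` such that for every `n`
there are `k ≥ ρ·2n`, a randomized encoder `E : {0,1}^k → {0,1}^n × {0,1}^n` and a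
decoder `D` with `D(E(x)) = x` with probability 1, such that for all tampering functions
`h₁, h₂` there is a distribution `G` over `NM_k` with
`Δ(D(h₁(L), h₂(R)), G(x)) ≤ 2^{-αk}` for every message `x`, where `(L,R) = E(x)`. -/
theorem stmt_11 :
    ∃ ρ : ℝ, ρ > 0 ∧
      ∃ α : ℝ, α > 0 ∧
        ∀ n : ℕ,
          ∃ k : ℕ, (k : ℝ) ≥ ρ * (2 * n) ∧
            ∃ (E : Bits k → PMF (Bits n × Bits n)) (D : Bits n × Bits n → Bits k),
              (∀ x : Bits k, (E x).map D = PMF.pure x) ∧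
              ∀ h₁ h₂ : Bits n → Bits n,
                ∃ G : PMF (Option (Bits k)),
                  ∀ x : Bits k,
                    sd ((E x).map fun c => D (h₁ c.1, h₂ c.2))
                       (G.map fun g => g.getD x) ≤ (2 : ℝ) ^ (-(α * k)) := by
  refine ⟨1 / 96, by norm_num, 1, one_pos, fun n => ?_⟩
  rcases Nat.eq_zero_or_pos n with rfl | hpos
  · refine ⟨0, by simp, fun _ => PMF.pure default, fun _ => default, fun x => ?_,
      fun h₁ h₂ => ⟨PMF.pure none, fun x => ?_⟩⟩
    · rw [PMF.pure_map]
      exact congrArg _ (Subsingleton.elim _ _)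
    · simpa using sd_le_one _ _
  rcases lt_or_ge n 48 with hn | hn
  · refine ⟨1, ?_, fun x => PMF.pure (fun _ => x 0, fun _ => false), fun c _ => c.1 ⟨0, hpos⟩,
      fun x => ?_, fun h₁ h₂ => ⟨(PMF.uniformOfFintype (Bits 1)).map some, fun x => ?_⟩⟩
    · have : (n : ℝ) < 48 := by exact_mod_cast hn
      push_cast
      linarith
    · rw [PMF.pure_map]
      congr 1
      ext i
      rw [Subsingleton.elim i 0]
    · rw [PMF.map_comp]
      have hmap : (PMF.uniformOfFintype (Bits 1)).map ((fun g => g.getD x) ∘ some) =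
          PMF.uniformOfFintype (Bits 1) := PMF.map_id _
      rw [hmap]
      exact (sd_uniform_bits_one_le _).trans (by norm_num [Real.rpow_neg_one])
  · obtain ⟨k, hk⟩ : ∃ k, k = n / 8 := ⟨_, rfl⟩
    let H : (Bits n → Bits n) × (Bits n → Bits n) → Bits n × Bits n → Bits n × Bits n :=
      fun h c => (h.1 c.1, h.2 c.2)
    obtain ⟨D, hD⟩ := exists_decoder (B := Bits k) H (δ := 1 / (4 * (2 ^ k) ^ 2))
      (by positivity)
      (by
        have : (1 : ℝ) ≤ 2 ^ k := one_le_pow₀ (by norm_num)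
        rw [div_le_one (by positivity)]
        nlinarith)
      (by simpa using card_bound hn hk)
    have hne : ∀ x, (Finset.univ.filter fun c => D c = x).Nonempty := by
      intro x
      by_contra hempty
      have hx : ∀ c, D c ≠ x := by
        simpa only [Finset.not_nonempty_iff_eq_empty, Finset.filter_eq_empty_iff,
          Finset.mem_univ, true_imp_iff] using hempty
      have h := hD x Finset.univ (id, id)
      have hK : (1 : ℝ) ≤ 2 ^ k := one_le_pow₀ (by norm_num)
      have hN : (0 : ℝ) < Fintype.card (Bits n × Bits n) := by exact_mod_cast Fintype.card_pos
      have hB : (Fintype.card (Bits k) : ℝ) = 2 ^ k := by simp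
      simp only [tamperedIndicator, hx, if_false, Finset.mem_univ, if_true, mul_one, zero_sub,
        Finset.sum_const, Finset.card_univ, nsmul_eq_mul, mul_neg, abs_neg, hB] at h
      rw [abs_of_pos (by positivity), mul_comm] at h
      have h' := le_of_mul_le_mul_right h hN
      rw [div_le_div_iff₀ (by positivity) (by positivity)] at h'
      nlinarith
    refine ⟨k, ?_, fun x => PMF.uniformOfFinset _ (hne x), D, fun x => ?_, fun h₁ h₂ => ?_⟩
    · have h1 : n ≤ 48 * k := by omega
      have h2 : (n : ℝ) ≤ 48 * k := by exact_mod_cast h1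
      linarith
    · exact uniformOfFinset_fiber_map D x (hne x)
    · obtain ⟨G, hG⟩ := exists_simulator D (H (h₁, h₂))
        (fun x T => by simpa using hD x T (h₁, h₂)) hne
      refine ⟨G, fun x => (hG x).trans_eq ?_⟩
      rw [one_mul, Real.rpow_neg (by norm_num), Real.rpow_natCast, one_div]
end
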